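/- arXiv:2110.14852 — 2 statements merged into one kernel-verified Lean document; each statement's English description precedes it below -/
import Mathlib

section
/- Exponential hypercontractivity of the Ornstein–Uhlenbeck semigroup: for any measurable f : ℝ^d → ℝ with e^f ∈ L^1(γ) and f ∈ L^1(γ), ‖exp(Q_t f)‖_{L^{e^{2t}}(γ)} ≤ ‖e^f‖_{L^1(γ)} for all t ≥ 0, where (Q_t f)(x) = ∫ f(e^{−t}x + √(1−e^{−2t})y) γ(dy). -/
open MeasureTheory ProbabilityTheory
open scoped ENNReal NNReal

noncomputable section

abbrev Ed (d : ℕ) : Type := EuclideanSpace ℝ (Fin d)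

/-- The standard Gaussian measure on `ℝ^d`. -/
def stdGaussian (d : ℕ) : Measure (Ed d) :=
  Measure.map (fun x : Fin d → ℝ => (WithLp.equiv 2 (Fin d → ℝ)).symm x)
    (Measure.pi fun _ : Fin d => gaussianReal 0 1)

/-- The Ornstein–Uhlenbeck semigroup `(Q_t f)(x) = ∫ f(e^{-t} x + √(1-e^{-2t}) y) γ(dy)`. -/
def OUsg {d : ℕ} (t : ℝ) (f : Ed d → ℝ) (x : Ed d) : ℝ :=
  ∫ y, f (Real.exp (-t) • x + Real.sqrt (1 - Real.exp (-2*t)) • y) ∂(stdGaussian d)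

/-- A function whose derivative at `x` has the sign of `x` is minimal at `0`. -/
lemma apply_zero_le_of_mul_deriv_nonneg {g g' : ℝ → ℝ}
    (hg : ∀ x, -1 < x → HasDerivAt g (g' x) x) (hg' : ∀ x, -1 < x → 0 ≤ x * g' x)
    {x : ℝ} (hx : -1 < x) : g 0 ≤ g x := by
  rcases lt_trichotomy x 0 with h | rfl | h
  · obtain ⟨c, hc, hc'⟩ := exists_hasDerivAt_eq_slope g g' h
      (fun y hy => (hg y (by linarith [hy.1])).continuousAt.continuousWithinAt)
      (fun y hy => hg y (by linarith [hy.1]))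
    have h1 := hg' c (by linarith [hc.1])
    have h2 : g' c ≤ 0 := by
      by_contra! h3
      nlinarith [hc.2]
    rw [hc', div_le_iff₀ (by linarith)] at h2
    linarith
  · exact le_rfl
  · obtain ⟨c, hc, hc'⟩ := exists_hasDerivAt_eq_slope g g' h
      (fun y hy => (hg y (by linarith [hy.1])).continuousAt.continuousWithinAt)
      (fun y hy => hg y (by linarith [hy.1]))
    have h1 := hg' c (by linarith [hc.1])
    have h2 : 0 ≤ g' c := by
      by_contra! h3
      nlinarith [hc.1]
    rw [hc', le_div_iff₀ (by linarith)] at h2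
    linarith

lemma log_one_add_le_cubic {w : ℝ} (hw : -1 < w) :
    Real.log (1 + w) ≤ w - w ^ 2 / 2 + w ^ 3 / 3 := by
  have key := apply_zero_le_of_mul_deriv_nonneg
    (g := fun w => w - w ^ 2 / 2 + w ^ 3 / 3 - Real.log (1 + w))
    (g' := fun w => 1 - w + w ^ 2 - 1 / (1 + w)) (fun x hx => ?_) (fun x hx => ?_) hw
  · simp at key
    linarith
  · have h1 := ((hasDerivAt_id x).const_add 1).log (by simp; linarith)
    have h2 := (((hasDerivAt_id x).sub (((hasDerivAt_id x).pow 2).div_const 2)).add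
      (((hasDerivAt_id x).pow 3).div_const 3)).sub h1
    refine HasDerivAt.congr_deriv h2 ?_
    simp
  · have h1 : 0 < 1 + x := by linarith
    have : x * (1 - x + x ^ 2 - 1 / (1 + x)) = (x ^ 2) ^ 2 / (1 + x) := by
      field_simp
      ring
    rw [this]
    positivity

lemma cubic_le_one_add_mul_log {z : ℝ} (hz : -1 < z) :
    z + z ^ 2 / 2 - z ^ 3 / 6 ≤ (1 + z) * Real.log (1 + z) := by
  have key := apply_zero_le_of_mul_deriv_nonneg
    (g := fun z => (1 + z) * Real.log (1 + z) - (z + z ^ 2 / 2 - z ^ 3 / 6))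
    (g' := fun z => Real.log (1 + z) - (z - z ^ 2 / 2)) (fun x hx => ?_) (fun x hx => ?_) hz
  · simp at key
    linarith
  · have h0 : 1 + x ≠ 0 := by linarith
    have h1 := ((hasDerivAt_id x).const_add 1).mul
      (((hasDerivAt_id x).const_add 1).log (by simpa using h0))
    have h2 := h1.sub (((hasDerivAt_id x).add (((hasDerivAt_id x).pow 2).div_const 2)).sub
      (((hasDerivAt_id x).pow 3).div_const 6))
    refine HasDerivAt.congr_deriv h2 ?_
    simp
    field_simp
    ring
  · rcases le_total 0 x with h | h
    · refine mul_nonneg h (sub_nonneg.2 (le_trans ?_ (Real.le_log_one_add_of_nonneg h)))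
      rw [le_div_iff₀ (by linarith)]
      nlinarith [pow_nonneg h 3]
    · refine mul_nonneg_of_nonpos_of_nonpos h ?_
      nlinarith [log_one_add_le_cubic hx, mul_nonneg_of_nonpos_of_nonpos h h,
        Odd.pow_nonpos (n := 3) (by decide) h]

lemma one_add_mul_log_sub_le {r B e τ z w z' w' : ℝ} (hr0 : 0 ≤ r) (hr1 : r ≤ 1)
    (hz : -1 < z) (hw : -1 < w) (hzB : |z| ≤ B) (hze : |z| ≤ e) (hwe : |w| ≤ e)
    (hze' : |z'| ≤ e) (hwe' : |w'| ≤ e) (hzτ : |z - z'| ≤ τ) (hwτ : |w - w'| ≤ τ) :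
    (1 + z) * Real.log (1 + w) - r * ((1 + z) * Real.log (1 + z))
      ≤ w - r * z + (z' * w' - w' ^ 2 / 2 - r * z' ^ 2 / 2)
        + ((1 + B) * e ^ 3 + 4 * (e * τ)) := by
  have h1 := mul_le_mul_of_nonneg_left (log_one_add_le_cubic hw) (by linarith : 0 ≤ 1 + z)
  have h2 := mul_le_mul_of_nonneg_left (cubic_le_one_add_mul_log hz) hr0
  have he : 0 ≤ e := (abs_nonneg z).trans hze
  have hB : 0 ≤ B := (abs_nonneg z).trans hzB
  have hτ : 0 ≤ τ := (abs_nonneg _).trans hzτ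
  have c1 : w ^ 3 ≤ e ^ 3 := (le_abs_self _).trans (by rw [abs_pow]; gcongr)
  have c2 : -(z * w ^ 2) ≤ e ^ 3 := by
    refine (neg_le_abs _).trans ?_
    rw [abs_mul, abs_pow, show e ^ 3 = e * e ^ 2 by ring]
    gcongr
  have c3 : z * w ^ 3 ≤ B * e ^ 3 := by
    refine (le_abs_self _).trans ?_
    rw [abs_mul, abs_pow]
    gcongr
  have c4 : r * z ^ 3 ≤ e ^ 3 := by
    refine (le_abs_self _).trans ?_
    rw [abs_mul, abs_pow, abs_of_nonneg hr0, show e ^ 3 = 1 * e ^ 3 by ring]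
    gcongr
  have prod_bound : ∀ p q p' q' : ℝ, |q| ≤ e → |p'| ≤ e → |p - p'| ≤ τ → |q - q'| ≤ τ →
      |p * q - p' * q'| ≤ 2 * (e * τ) := fun p q p' q' hq hp' hp hqq => by
    rw [show p * q - p' * q' = (p - p') * q + p' * (q - q') by ring]
    refine (abs_add_le _ _).trans ?_
    rw [abs_mul, abs_mul]
    have := mul_le_mul hp hq (abs_nonneg _) hτ
    have := mul_le_mul hp' hqq (abs_nonneg _) he
    linarith
  have q1 := (abs_le.1 (prod_bound z w z' w' hwe hze' hzτ hwτ)).2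
  have q2 := (abs_le.1 (prod_bound w w w' w' hwe hwe' hwτ hwτ)).1
  have q3 := (abs_le.1 (prod_bound z z z' z' hze hze' hzτ hzτ)).1
  have q4 := mul_le_mul_of_nonneg_left q3 hr0
  have q5 : r * (e * τ) ≤ 1 * (e * τ) := by gcongr
  have e3 : 0 ≤ e ^ 3 := by positivity
  have e4 : 0 ≤ B * e ^ 3 := by positivity
  nlinarith

/-- The function `(u, v) ↦ u log v - r u log u`, the Legendre dual form of the inequality. -/
def entropyForm (r u v : ℝ) : ℝ := u * Real.log v - r * (u * Real.log u)

lemma entropyForm_le_of_near {r a b u v U V ℓ k η θ : ℝ} (ha : 0 < a) (hr0 : 0 ≤ r) (hr1 : r ≤ 1)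
    (hu : u ∈ Set.Icc a b) (hv : v ∈ Set.Icc a b) (hU : U ∈ Set.Icc a b) (hV : V ∈ Set.Icc a b)
    (hUη : |U - u| ≤ η) (hVη : |V - v| ≤ η) (hℓη : |ℓ| ≤ η) (hkη : |k| ≤ η)
    (hUθ : |U - u - ℓ| ≤ θ) (hVθ : |V - v - k| ≤ θ) :
    entropyForm r U V ≤ entropyForm r u v
      + ((Real.log v - r * Real.log u - r) * (U - u) + u / v * (V - v))
      + u * ((ℓ / u) * (k / v) - (k / v) ^ 2 / 2 - r * (ℓ / u) ^ 2 / 2)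
      + b * ((1 + b / a) * (η / a) ^ 3 + 4 * ((η / a) * (θ / a))) := by
  have hu0 : 0 < u := ha.trans_le hu.1
  have hv0 : 0 < v := ha.trans_le hv.1
  have hU0 : 0 < U := ha.trans_le hU.1
  have hV0 : 0 < V := ha.trans_le hV.1
  have hb : 0 < b := hu0.trans_le hu.2
  have hη : 0 ≤ η := (abs_nonneg _).trans hkη
  have hθ : 0 ≤ θ := (abs_nonneg _).trans hUθ
  have div_bound : ∀ {p q c : ℝ}, a ≤ q → |p| ≤ c → |p / q| ≤ c / a := fun {p q c} hq hp => by
    rw [abs_div, abs_of_pos (ha.trans_le hq)]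
    exact div_le_div₀ ((abs_nonneg _).trans hp) hp ha hq
  have hz1 : 1 + (U - u) / u = U / u := by field_simp; ring
  have hw1 : 1 + (V - v) / v = V / v := by field_simp; ring
  have key := one_add_mul_log_sub_le (r := r) (B := b / a) (e := η / a) (τ := θ / a)
    (z := (U - u) / u) (w := (V - v) / v) (z' := ℓ / u) (w' := k / v) hr0 hr1
    (by have := div_pos hU0 hu0; linarith) (by have := div_pos hV0 hv0; linarith)
    (div_bound hu.1 (abs_le.2 ⟨by linarith [hU.1, hu.2], by linarith [hU.2]⟩))
    (div_bound hu.1 hUη) (div_bound hv.1 hVη) (div_bound hu.1 hℓη) (div_bound hv.1 hkη)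
    (by rw [← sub_div]; exact div_bound hu.1 hUθ) (by rw [← sub_div]; exact div_bound hv.1 hVθ)
  rw [hz1, hw1, Real.log_div hV0.ne' hv0.ne', Real.log_div hU0.ne' hu0.ne'] at key
  have key2 := mul_le_mul_of_nonneg_left key hu0.le
  have hrest : 0 ≤ (1 + b / a) * (η / a) ^ 3 + 4 * ((η / a) * (θ / a)) := by positivity
  have key3 := mul_le_mul_of_nonneg_right hu.2 hrest
  have e1 : u * (U / u * (Real.log V - Real.log v) - r * (U / u * (Real.log U - Real.log u)))
      = entropyForm r U V - U * Real.log v + r * (U * Real.log u) := by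
    rw [entropyForm]; field_simp; ring
  have e2 : u * ((V - v) / v - r * ((U - u) / u)) = u / v * (V - v) - r * (U - u) := by
    field_simp
  rw [e1] at key2
  have e3 : entropyForm r u v = u * Real.log v - r * (u * Real.log u) := rfl
  rw [e3]
  linarith

section Averaging

variable {W E G : Type*} [NormedAddCommGroup W] [NormedSpace ℝ W] [MeasurableSpace W]
  [NormedAddCommGroup E] [NormedSpace ℝ E] [NormedAddCommGroup G] [NormedSpace ℝ G]

/-- The average of `Θ` over `w + √s • μ`: the heat semigroup when `μ` is a centered Gaussian. -/
def scaledAverage (μ : Measure W) (s : ℝ) (Θ : W → G) (w : W) : G :=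
  ∫ w', Θ (w + √s • w') ∂μ

/-- `U` is valued in `[a, b]`, and has a first-order expansion of the form `α w ∘ L` with
constants controlled by `C`. -/
structure SmoothAlong (L : W →L[ℝ] E) (a b C : ℝ) (U : W → ℝ) (α : W → StrongDual ℝ E) :
    Prop where
  measurable : Measurable U
  mem_Icc : ∀ w, U w ∈ Set.Icc a b
  stronglyMeasurable : StronglyMeasurable α
  norm_le : ∀ w, ‖α w‖ ≤ C
  lipschitz : ∀ w h, |U (w + h) - U w| ≤ C * ‖h‖
  taylor : ∀ w h, |U (w + h) - U w - α w (L h)| ≤ C * ‖h‖ ^ 2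

lemma integrable_of_mem_Icc {Ω : Type*} [MeasurableSpace Ω] {μ : Measure Ω} [IsFiniteMeasure μ]
    {f : Ω → ℝ} {a b : ℝ} (hf : Measurable f) (hab : ∀ x, f x ∈ Set.Icc a b) : Integrable f μ :=
  Integrable.of_mem_Icc a b hf.aemeasurable (ae_of_all _ hab)

lemma integral_mem_Icc {Ω : Type*} [MeasurableSpace Ω] {μ : Measure Ω} [IsProbabilityMeasure μ]
    {f : Ω → ℝ} {a b : ℝ} (hf : Measurable f) (hab : ∀ x, f x ∈ Set.Icc a b) :
    ∫ x, f x ∂μ ∈ Set.Icc a b := by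
  have hi := integrable_of_mem_Icc (μ := μ) hf hab
  constructor
  · simpa using integral_mono (integrable_const a) hi fun x => (hab x).1
  · simpa using integral_mono hi (integrable_const b) fun x => (hab x).2

lemma abs_integral_le_of_abs_le {Ω : Type*} [MeasurableSpace Ω] {μ : Measure Ω} {f g : Ω → ℝ}
    (hg : Integrable g μ) (h : ∀ x, |f x| ≤ g x) : |∫ x, f x ∂μ| ≤ ∫ x, g x ∂μ :=
  norm_integral_le_of_norm_le (f := f) hg (ae_of_all _ h)

lemma entropyForm_mem_Icc {r a b : ℝ} (ha : 0 < a) (hr0 : 0 ≤ r) (hr1 : r ≤ 1) :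
    ∃ M, ∀ u ∈ Set.Icc a b, ∀ v ∈ Set.Icc a b, entropyForm r u v ∈ Set.Icc (-M) M := by
  have log_bound : ∀ u ∈ Set.Icc a b, |Real.log u| ≤ |Real.log a| + |Real.log b| := fun u hu => by
    have h1 := Real.log_le_log ha hu.1
    have h2 := Real.log_le_log (ha.trans_le hu.1) hu.2
    rw [abs_le]
    constructor
    · linarith [neg_abs_le (Real.log a), abs_nonneg (Real.log b)]
    · linarith [le_abs_self (Real.log b), abs_nonneg (Real.log a)]
  refine ⟨2 * (b * (|Real.log a| + |Real.log b|)), fun u hu v hv => abs_le.1 ?_⟩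
  have hu0 : 0 ≤ u := (ha.trans_le hu.1).le
  have hb0 : 0 ≤ b := hu0.trans hu.2
  have h1 : |u * Real.log v| ≤ b * (|Real.log a| + |Real.log b|) := by
    rw [abs_mul, abs_of_nonneg hu0]
    exact mul_le_mul hu.2 (log_bound v hv) (abs_nonneg _) hb0
  have h2 : |r * (u * Real.log u)| ≤ 1 * (b * (|Real.log a| + |Real.log b|)) := by
    rw [abs_mul, abs_of_nonneg hr0, abs_mul, abs_of_nonneg hu0]
    exact mul_le_mul hr1 (mul_le_mul hu.2 (log_bound u hu) (abs_nonneg _) hb0) (by positivity)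
      zero_le_one
  refine (abs_sub _ _).trans ?_
  linarith

@[fun_prop]
lemma Measurable.entropyForm {Ω : Type*} [MeasurableSpace Ω] {r : ℝ} {f g : Ω → ℝ}
    (hf : Measurable f) (hg : Measurable g) : Measurable fun x => entropyForm r (f x) (g x) := by
  unfold _root_.entropyForm
  fun_prop

variable {μ : Measure W} {L : W →L[ℝ] E} {a b C : ℝ} {U : W → ℝ} {α : W → StrongDual ℝ E}

namespace SmoothAlong

lemma mono {C' : ℝ} (hU : SmoothAlong L a b C U α) (hC : C ≤ C') : SmoothAlong L a b C' U α where
  measurable := hU.measurable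
  mem_Icc := hU.mem_Icc
  stronglyMeasurable := hU.stronglyMeasurable
  norm_le w := (hU.norm_le w).trans hC
  lipschitz w h := (hU.lipschitz w h).trans (by gcongr)
  taylor w h := (hU.taylor w h).trans (by gcongr)

variable [BorelSpace W]

lemma integrable_shift [IsFiniteMeasure μ] (hU : SmoothAlong L a b C U α) (s : ℝ) (w : W) :
    Integrable (fun w' => U (w + √s • w')) μ :=
  integrable_of_mem_Icc (hU.measurable.comp (by fun_prop)) fun _ => hU.mem_Icc _

lemma integrable_deriv_shift [IsFiniteMeasure μ] (hU : SmoothAlong L a b C U α) (s : ℝ) (w : W) :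
    Integrable (fun w' => α (w + √s • w')) μ :=
  .of_bound (hU.stronglyMeasurable.comp_measurable (by fun_prop)).aestronglyMeasurable C
    (ae_of_all _ fun _ => hU.norm_le _)

lemma scaledAverage [SecondCountableTopology W] [IsProbabilityMeasure μ]
    (hU : SmoothAlong L a b C U α) (s : ℝ) :
    SmoothAlong L a b C (scaledAverage μ s U) (scaledAverage μ s α) where
  measurable := by
    have : StronglyMeasurable (fun p : W × W => U (p.1 + √s • p.2)) :=
      (hU.measurable.comp (by fun_prop)).stronglyMeasurable
    exact this.integral_prod_right.measurable
  mem_Icc w := integral_mem_Icc (hU.measurable.comp (by fun_prop)) fun _ => hU.mem_Icc _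
  stronglyMeasurable := by
    have : StronglyMeasurable (fun p : W × W => α (p.1 + √s • p.2)) :=
      hU.stronglyMeasurable.comp_measurable (by fun_prop)
    exact this.integral_prod_right
  norm_le w := by
    simpa using! norm_integral_le_of_norm_le_const (μ := μ)
      (ae_of_all _ fun w' => hU.norm_le (w + √s • w'))
  lipschitz w h := by
    have := abs_integral_le_of_abs_le (integrable_const (μ := μ) (C * ‖h‖))
      fun w' => hU.lipschitz (w + √s • w') h
    simp_rw [add_right_comm _ _ h] at this
    rw [integral_sub (hU.integrable_shift _ _) (hU.integrable_shift _ _)] at this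
    simpa using! this
  taylor w h := by
    have := abs_integral_le_of_abs_le (integrable_const (μ := μ) (C * ‖h‖ ^ 2))
      fun w' => hU.taylor (w + √s • w') h
    simp_rw [add_right_comm _ _ h] at this
    have hsub : Integrable (fun x => U (w + h + √s • x) - U (w + √s • x)) μ :=
      (hU.integrable_shift _ _).sub (hU.integrable_shift _ _)
    rw [integral_sub hsub
      ((hU.integrable_deriv_shift _ _).apply_continuousLinearMap _),
      integral_sub (hU.integrable_shift _ _) (hU.integrable_shift _ _),
      ← ContinuousLinearMap.integral_apply (hU.integrable_deriv_shift _ _)] at this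
    simpa using! this

end SmoothAlong

variable [BorelSpace W] [SecondCountableTopology W] [CompleteSpace W] [IsGaussian μ]

lemma IsGaussian.integrable_norm_pow (μ : Measure W) [IsGaussian μ] (n : ℕ) :
    Integrable (fun w => ‖w‖ ^ n) μ :=
  (IsGaussian.memLp_id μ n (by simp)).integrable_norm_pow'

lemma IsGaussian.integrable_one_add_norm_pow (μ : Measure W) [IsGaussian μ] (n : ℕ) :
    Integrable (fun w => (1 + ‖w‖) ^ n) μ := by
  have h₁ : MemLp (fun w : W => ‖w‖) n μ := (IsGaussian.memLp_id μ n (by simp)).norm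
  have h₂ : MemLp (fun w : W => 1 + ‖w‖) n μ := (memLp_const (1 : ℝ)).add h₁
  have h₃ : ∀ w : W, ‖1 + ‖w‖‖ = 1 + ‖w‖ := fun w => Real.norm_of_nonneg (by positivity)
  have h₄ := h₂.integrable_norm_pow'
  simp_rw [h₃] at h₄
  exact h₄

namespace SmoothAlong

lemma deviation_bounds (hμ : ∫ w, w ∂μ = 0) (hC : 0 ≤ C) (hU : SmoothAlong L a b C U α) {D : ℝ}
    (hD : C * (1 + ∫ w, ‖w‖ ∂μ + ∫ w, ‖w‖ ^ 2 ∂μ + ‖L‖) ≤ D) (s : ℝ) (w w' : W) :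
    |U (w + √s • w') - _root_.scaledAverage μ s U w| ≤ D * √s * (1 + ‖w'‖) ∧
    |√s * α w (L w')| ≤ D * √s * (1 + ‖w'‖) ∧
    |U (w + √s • w') - _root_.scaledAverage μ s U w - √s * α w (L w')|
      ≤ D * √s ^ 2 * (1 + ‖w'‖) ^ 2 := by
  set m₁ := ∫ w, ‖w‖ ∂μ with hm₁
  set m₂ := ∫ w, ‖w‖ ^ 2 ∂μ with hm₂
  have m₁_nonneg : 0 ≤ m₁ := integral_nonneg fun _ => norm_nonneg _
  have m₂_nonneg : 0 ≤ m₂ := integral_nonneg fun _ => sq_nonneg _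
  have hε : 0 ≤ √s := Real.sqrt_nonneg s
  have i₁ : Integrable (fun w : W => ‖w‖) μ := by simpa using IsGaussian.integrable_norm_pow μ 1
  have i₂ : Integrable (fun w : W => ‖w‖ ^ 2) μ := IsGaussian.integrable_norm_pow μ 2
  have lin_zero : ∫ x, √s * α w (L x) ∂μ = 0 := by
    rw [integral_const_mul]
    have := IsGaussian.integral_dual (μ := μ) ((α w).comp L)
    rw [hμ, map_zero] at this
    rw [show ∫ x, α w (L x) ∂μ = 0 from this, mul_zero]
  have i₃ : Integrable (fun x => √s * α w (L x)) μ :=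
    (IsGaussian.integrable_dual μ ((α w).comp L)).const_mul _
  have nrm : ∀ x : W, ‖√s • x‖ = √s * ‖x‖ := fun x => by
    rw [norm_smul, Real.norm_of_nonneg hε]
  have lip : ∀ x, |U (w + √s • x) - U w| ≤ C * √s * ‖x‖ := fun x => by
    have := hU.lipschitz w (√s • x)
    rwa [nrm, ← mul_assoc] at this
  have tay : ∀ x, |U (w + √s • x) - U w - √s * α w (L x)| ≤ C * √s ^ 2 * ‖x‖ ^ 2 := fun x => by
    have := hU.taylor w (√s • x)
    rwa [nrm, map_smul, map_smul, smul_eq_mul, mul_pow, ← mul_assoc] at this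
  have mean_lip : |_root_.scaledAverage μ s U w - U w| ≤ C * √s * m₁ := by
    have h := abs_integral_le_of_abs_le (i₁.const_mul (C * √s)) lip
    rw [integral_sub (hU.integrable_shift _ _) (integrable_const _), integral_const_mul] at h
    simpa using! h
  have mean_tay : |_root_.scaledAverage μ s U w - U w| ≤ C * √s ^ 2 * m₂ := by
    have h := abs_integral_le_of_abs_le (i₂.const_mul (C * √s ^ 2)) tay
    have hsub : Integrable (fun x => U (w + √s • x) - U w) μ :=
      (hU.integrable_shift _ _).sub (integrable_const _)
    rw [integral_sub hsub i₃, lin_zero,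
      integral_sub (hU.integrable_shift _ _) (integrable_const _), integral_const_mul] at h
    simpa using! h
  have hx := norm_nonneg w'
  have hL := norm_nonneg L
  refine ⟨?_, ?_, ?_⟩
  · calc |U (w + √s • w') - _root_.scaledAverage μ s U w|
        = |(U (w + √s • w') - U w) - (_root_.scaledAverage μ s U w - U w)| := by ring_nf
      _ ≤ C * √s * ‖w'‖ + C * √s * m₁ := (abs_sub _ _).trans (add_le_add (lip _) mean_lip)
      _ = C * (‖w'‖ + m₁) * √s := by ring
      _ ≤ C * ((1 + m₁ + m₂ + ‖L‖) * (1 + ‖w'‖)) * √s := by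
          gcongr
          nlinarith [mul_nonneg m₁_nonneg hx, mul_nonneg m₂_nonneg hx, mul_nonneg hL hx]
      _ = C * (1 + m₁ + m₂ + ‖L‖) * √s * (1 + ‖w'‖) := by ring
      _ ≤ _ := by gcongr
  · calc |√s * α w (L w')| = √s * |α w (L w')| := by rw [abs_mul, abs_of_nonneg hε]
      _ ≤ √s * (C * (‖L‖ * ‖w'‖)) := by
          gcongr
          exact ((α w).le_opNorm _).trans
            (mul_le_mul (hU.norm_le w) (L.le_opNorm _) (norm_nonneg _) hC)
      _ ≤ √s * (C * ((1 + m₁ + m₂ + ‖L‖) * (1 + ‖w'‖))) := by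
          gcongr
          · linarith
          · linarith
      _ = C * (1 + m₁ + m₂ + ‖L‖) * √s * (1 + ‖w'‖) := by ring
      _ ≤ _ := by gcongr
  · calc |U (w + √s • w') - _root_.scaledAverage μ s U w - √s * α w (L w')|
        = |(U (w + √s • w') - U w - √s * α w (L w')) - (_root_.scaledAverage μ s U w - U w)| := by
          ring_nf
      _ ≤ C * √s ^ 2 * ‖w'‖ ^ 2 + C * √s ^ 2 * m₂ :=
          (abs_sub _ _).trans (add_le_add (tay _) mean_tay)
      _ = C * (‖w'‖ ^ 2 + m₂) * √s ^ 2 := by ring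
      _ ≤ C * ((1 + m₁ + m₂ + ‖L‖) * (1 + ‖w'‖) ^ 2) * √s ^ 2 := by
          gcongr
          have h1 : 1 ≤ (1 + ‖w'‖) ^ 2 := one_le_pow₀ (by linarith)
          have h2 : ‖w'‖ ^ 2 ≤ (1 + ‖w'‖) ^ 2 := by gcongr; linarith
          nlinarith [mul_nonneg m₁_nonneg (sub_nonneg.2 h1),
            mul_nonneg m₂_nonneg (sub_nonneg.2 h1), mul_nonneg hL (sub_nonneg.2 h1)]
      _ = C * (1 + m₁ + m₂ + ‖L‖) * √s ^ 2 * (1 + ‖w'‖) ^ 2 := by ring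
      _ ≤ _ := by gcongr

end SmoothAlong

lemma exists_scaledAverage_entropyForm_le (hμ : ∫ w, w ∂μ = 0) {L₁ L₂ : W →L[ℝ] E} {r : ℝ}
    (ha : 0 < a) (hC : 0 ≤ C) (hr0 : 0 ≤ r) (hr1 : r ≤ 1)
    (hcov : ∀ ℓ k : StrongDual ℝ E,
      ∫ w, (ℓ (L₁ w) * k (L₂ w) - k (L₂ w) ^ 2 / 2 - r * ℓ (L₁ w) ^ 2 / 2) ∂μ ≤ 0) :
    ∃ K, ∀ U V α β, SmoothAlong L₁ a b C U α → SmoothAlong L₂ a b C V β → ∀ s w,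
      scaledAverage μ s (fun x => entropyForm r (U x) (V x)) w
        ≤ entropyForm r (scaledAverage μ s U w) (scaledAverage μ s V w) + K * √s ^ 3 := by
  set D := max (C * (1 + ∫ w, ‖w‖ ∂μ + ∫ w, ‖w‖ ^ 2 ∂μ + ‖L₁‖))
    (C * (1 + ∫ w, ‖w‖ ∂μ + ∫ w, ‖w‖ ^ 2 ∂μ + ‖L₂‖)) with hD
  set c := b * ((1 + b / a) * (D / a) ^ 3 + 4 * ((D / a) * (D / a))) with hc
  refine ⟨c * ∫ w, (1 + ‖w‖) ^ 3 ∂μ, fun U V α β hU hV s w => ?_⟩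
  have bU := hU.deviation_bounds hμ hC (le_max_left _ _ : _ ≤ D) s w
  have bV := hV.deviation_bounds hμ hC (le_max_right _ _ : _ ≤ D) s w
  have mU := (hU.scaledAverage (μ := μ) s).mem_Icc w
  have mV := (hV.scaledAverage (μ := μ) s).mem_Icc w
  have iU := hU.integrable_shift (μ := μ) s w
  have iV := hV.integrable_shift (μ := μ) s w
  have dU : Integrable (fun w' => U (w + √s • w') - scaledAverage μ s U w) μ :=
    iU.sub (integrable_const _)
  have dV : Integrable (fun w' => V (w + √s • w') - scaledAverage μ s V w) μ :=
    iV.sub (integrable_const _)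
  have zU : ∫ w', (U (w + √s • w') - scaledAverage μ s U w) ∂μ = 0 := by
    rw [integral_sub iU (integrable_const _)]
    simp [scaledAverage]
  have zV : ∫ w', (V (w + √s • w') - scaledAverage μ s V w) ∂μ = 0 := by
    rw [integral_sub iV (integrable_const _)]
    simp [scaledAverage]
  set u := scaledAverage μ s U w with hu
  set v := scaledAverage μ s V w with hv
  have hu0 : 0 < u := ha.trans_le mU.1
  set Q : W → ℝ := fun w' => (u⁻¹ • α w) (L₁ w') * (v⁻¹ • β w) (L₂ w')
    - (v⁻¹ • β w) (L₂ w') ^ 2 / 2 - r * (u⁻¹ • α w) (L₁ w') ^ 2 / 2 with hQ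
  have hQ_nonpos : ∫ w', Q w' ∂μ ≤ 0 := hcov _ _
  have iQ : Integrable Q μ := by
    have m₁ : MemLp (fun w' => (u⁻¹ • α w) (L₁ w')) 2 μ :=
      IsGaussian.memLp_dual μ ((u⁻¹ • α w).comp L₁) 2 (by simp)
    have m₂ : MemLp (fun w' => (v⁻¹ • β w) (L₂ w')) 2 μ :=
      IsGaussian.memLp_dual μ ((v⁻¹ • β w).comp L₂) 2 (by simp)
    exact ((m₁.integrable_mul m₂).sub (m₂.integrable_sq.div_const 2)).sub
      ((m₁.integrable_sq.const_mul r).div_const 2)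
  have iN := IsGaussian.integrable_one_add_norm_pow μ 3
  have pointwise : ∀ w', entropyForm r (U (w + √s • w')) (V (w + √s • w'))
      ≤ entropyForm r u v + ((Real.log v - r * Real.log u - r) * (U (w + √s • w') - u)
        + u / v * (V (w + √s • w') - v)) + u * √s ^ 2 * Q w'
        + c * √s ^ 3 * (1 + ‖w'‖) ^ 3 := fun w' => by
    refine (entropyForm_le_of_near ha hr0 hr1 mU mV (hU.mem_Icc _) (hV.mem_Icc _) (bU w').1
      (bV w').1 (bU w').2.1 (bV w').2.1 (bU w').2.2 (bV w').2.2).trans (le_of_eq ?_)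
    simp only [hQ, hc, smul_apply, smul_eq_mul]
    ring
  have iL : Integrable (fun w' => (Real.log v - r * Real.log u - r) * (U (w + √s • w') - u)
      + u / v * (V (w + √s • w') - v)) μ :=
    (dU.const_mul _).add (dV.const_mul _)
  obtain ⟨M, hM⟩ := entropyForm_mem_Icc (b := b) ha hr0 hr1
  have iJ : Integrable (fun w' => entropyForm r (U (w + √s • w')) (V (w + √s • w'))) μ :=
    integrable_of_mem_Icc (Measurable.entropyForm (hU.measurable.comp (by fun_prop))
      (hV.measurable.comp (by fun_prop))) fun _ => hM _ (hU.mem_Icc _) _ (hV.mem_Icc _)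
  have i₁ : Integrable (fun w' => entropyForm r u v
      + ((Real.log v - r * Real.log u - r) * (U (w + √s • w') - u)
        + u / v * (V (w + √s • w') - v))) μ := (integrable_const _).add iL
  have i₂ : Integrable (fun w' => entropyForm r u v
      + ((Real.log v - r * Real.log u - r) * (U (w + √s • w') - u)
        + u / v * (V (w + √s • w') - v)) + u * √s ^ 2 * Q w') μ := i₁.add (iQ.const_mul _)
  have h := integral_mono iJ (i₂.add (iN.const_mul (c * √s ^ 3))) pointwise
  have hlin : ∫ w', ((Real.log v - r * Real.log u - r) * (U (w + √s • w') - u)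
      + u / v * (V (w + √s • w') - v)) ∂μ = 0 := by
    rw [integral_add (dU.const_mul _) (dV.const_mul _), integral_const_mul, integral_const_mul,
      zU, zV]
    simp
  have hsum := integral_add i₂ (iN.const_mul (c * √s ^ 3))
  rw [integral_add i₁ (iQ.const_mul _), integral_add (integrable_const _) iL, hlin,
    integral_const_mul, integral_const_mul] at hsum
  refine h.trans ((le_of_eq hsum).trans ?_)
  have : u * √s ^ 2 * ∫ w', Q w' ∂μ ≤ 0 := mul_nonpos_of_nonneg_of_nonpos (by positivity) hQ_nonpos
  simp only [integral_const, probReal_univ, one_smul]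
  linarith

/-- A centered Gaussian measure is stable under linear combinations with coefficients on the unit
circle. -/
lemma map_add_smul_prod_eq (hμ : ∫ w, w ∂μ = 0) {c s : ℝ} (hcs : c ^ 2 + s ^ 2 = 1) :
    (μ.prod μ).map (fun p : W × W => c • p.1 + s • p.2) = μ := by
  obtain ⟨θ, hθ⟩ : ∃ θ : ℝ, c = Real.cos θ ∧ s = Real.sin θ := by
    have hn : ‖(⟨c, s⟩ : ℂ)‖ = 1 := by
      rw [Complex.norm_def, Complex.normSq_mk, ← pow_two, ← pow_two, hcs, Real.sqrt_one]
    refine ⟨Complex.arg ⟨c, s⟩, ?_, ?_⟩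
    · rw [Complex.cos_arg (by intro h; simp [h] at hn), hn, div_one]
    · rw [Complex.sin_arg, hn, div_one]
  have h := IsGaussian.map_rotation_eq_self (μ := μ) hμ θ
  have h' := congrArg (Measure.map Prod.fst) h
  rw [Measure.map_map measurable_fst (by fun_prop), Measure.map_fst_prod] at h'
  rw [hθ.1, hθ.2]
  simpa [Function.comp_def] using! h'

lemma scaledAverage_scaledAverage (hμ : ∫ w, w ∂μ = 0) {Θ : W → ℝ} {M : ℝ} (hΘ : Measurable Θ)
    (hM : ∀ w, Θ w ∈ Set.Icc (-M) M) {s t : ℝ} (hs : 0 < s) (ht : 0 ≤ t) (w : W) :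
    scaledAverage μ s (scaledAverage μ t Θ) w = scaledAverage μ (s + t) Θ w := by
  have hst : 0 < s + t := by linarith
  have hstab := map_add_smul_prod_eq hμ (c := √s / √(s + t)) (s := √t / √(s + t)) (by
    rw [div_pow, div_pow, Real.sq_sqrt hs.le, Real.sq_sqrt ht, Real.sq_sqrt hst.le]
    field_simp)
  have h0 : √(s + t) ≠ 0 := (Real.sqrt_pos.2 hst).ne'
  have hmeas : Measurable fun w' => Θ (w + √(s + t) • w') := hΘ.comp (by fun_prop)
  unfold scaledAverage
  conv_rhs => rw [← hstab]
  rw [integral_map (by fun_prop) hmeas.aestronglyMeasurable, integral_prod]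
  · refine integral_congr_ae (ae_of_all _ fun x => integral_congr_ae (ae_of_all _ fun y => ?_))
    simp only [smul_add, smul_smul, mul_div_cancel₀ _ h0, add_assoc]
  · exact integrable_of_mem_Icc (hmeas.comp (by fun_prop)) fun _ => hM _

lemma integral_entropyForm_le_of_smoothAlong (hμ : ∫ w, w ∂μ = 0) {L₁ L₂ : W →L[ℝ] E} {r : ℝ}
    (ha : 0 < a) (hC : 0 ≤ C) (hr0 : 0 ≤ r) (hr1 : r ≤ 1)
    (hcov : ∀ ℓ k : StrongDual ℝ E,
      ∫ w, (ℓ (L₁ w) * k (L₂ w) - k (L₂ w) ^ 2 / 2 - r * ℓ (L₁ w) ^ 2 / 2) ∂μ ≤ 0)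
    {V : W → ℝ} {β : W → StrongDual ℝ E}
    (hU : SmoothAlong L₁ a b C U α) (hV : SmoothAlong L₂ a b C V β) :
    ∫ w, entropyForm r (U w) (V w) ∂μ ≤ entropyForm r (∫ w, U w ∂μ) (∫ w, V w ∂μ) := by
  obtain ⟨K, hK⟩ := exists_scaledAverage_entropyForm_le hμ ha hC hr0 hr1 hcov
  obtain ⟨M, hM⟩ := entropyForm_mem_Icc (b := b) ha hr0 hr1
  have mem_symm : ∀ x ∈ Set.Icc a b, x ∈ Set.Icc (-b) b := fun x hx =>
    ⟨by linarith [hx.1, hx.2], hx.2⟩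
  have iterate : ∀ (s : ℝ), 0 < s → ∀ n : ℕ, ∀ w,
      scaledAverage μ (n * s) (fun x => entropyForm r (U x) (V x)) w
        ≤ entropyForm r (scaledAverage μ (n * s) U w) (scaledAverage μ (n * s) V w)
          + n * (K * √s ^ 3) := by
    intro s hs n
    induction n with
    | zero => intro w; simp [scaledAverage]
    | succ n ih =>
      intro w
      have hns : (0 : ℝ) ≤ n * s := by positivity
      have hUn := hU.scaledAverage (μ := μ) (n * s)
      have hVn := hV.scaledAverage (μ := μ) (n * s)
      have hmJ : Measurable fun x => entropyForm r (U x) (V x) :=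
        hU.measurable.entropyForm hV.measurable
      have hbJ : ∀ x, entropyForm r (U x) (V x) ∈ Set.Icc (-M) M :=
        fun x => hM _ (hU.mem_Icc x) _ (hV.mem_Icc x)
      have hmJn : Measurable (scaledAverage μ (n * s) fun x => entropyForm r (U x) (V x)) := by
        have : StronglyMeasurable (fun p : W × W =>
            entropyForm r (U (p.1 + √(n * s) • p.2)) (V (p.1 + √(n * s) • p.2))) :=
          (hmJ.comp (by fun_prop : Measurable fun p : W × W => p.1 + √(n * s) • p.2)
            ).stronglyMeasurable
        exact this.integral_prod_right.measurable
      have hbJn : ∀ x, scaledAverage μ (n * s) (fun x => entropyForm r (U x) (V x)) x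
          ∈ Set.Icc (-M) M :=
        fun x => integral_mem_Icc (hmJ.comp (by fun_prop)) fun _ => hbJ _
      rw [show ((n + 1 : ℕ) : ℝ) * s = s + n * s by push_cast; ring,
        ← scaledAverage_scaledAverage hμ hmJ hbJ hs hns,
        ← scaledAverage_scaledAverage hμ hU.measurable (fun x => mem_symm _ (hU.mem_Icc x)) hs hns,
        ← scaledAverage_scaledAverage hμ hV.measurable (fun x => mem_symm _ (hV.mem_Icc x)) hs hns]
      have iR : Integrable (fun w' => entropyForm r (scaledAverage μ (n * s) U (w + √s • w'))
          (scaledAverage μ (n * s) V (w + √s • w'))) μ :=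
        integrable_of_mem_Icc (Measurable.entropyForm (hUn.measurable.comp (by fun_prop))
          (hVn.measurable.comp (by fun_prop))) fun _ => hM _ (hUn.mem_Icc _) _ (hVn.mem_Icc _)
      have h₁ := integral_mono (μ := μ)
        (integrable_of_mem_Icc (hmJn.comp (by fun_prop : Measurable fun w' => w + √s • w'))
          fun _ => hbJn _)
        (iR.add (integrable_const (n * (K * √s ^ 3)))) fun w' => ih (w + √s • w')
      have h₂ := integral_add iR (integrable_const (μ := μ) (n * (K * √s ^ 3)))
      rw [integral_const, probReal_univ, one_smul] at h₂
      have h₃ := hK _ _ _ _ hUn hVn s w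
      refine h₁.trans ((le_of_eq h₂).trans ?_)
      unfold scaledAverage at h₃ ⊢
      push_cast
      linarith
  have bound : ∀ n : ℕ, ∫ w, entropyForm r (U w) (V w) ∂μ
      ≤ entropyForm r (∫ w, U w ∂μ) (∫ w, V w ∂μ) + K * √(((n : ℝ) + 1)⁻¹) := fun n => by
    have hn : (0 : ℝ) < (n : ℝ) + 1 := by positivity
    have h := iterate ((n : ℝ) + 1)⁻¹ (inv_pos.2 hn) (n + 1) 0
    have h1 : ((n + 1 : ℕ) : ℝ) * ((n : ℝ) + 1)⁻¹ = 1 := by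
      push_cast
      exact mul_inv_cancel₀ hn.ne'
    have h2 : ((n + 1 : ℕ) : ℝ) * (K * √(((n : ℝ) + 1)⁻¹) ^ 3) = K * √(((n : ℝ) + 1)⁻¹) := by
      rw [pow_succ, Real.sq_sqrt (inv_pos.2 hn).le]
      linear_combination K * √(((n : ℝ) + 1)⁻¹) * h1
    rw [h1, h2] at h
    simpa [scaledAverage] using h
  refine ge_of_tendsto' (x := Filter.atTop) ?_ bound
  have : Filter.Tendsto (fun n : ℕ => √(((n : ℝ) + 1)⁻¹)) Filter.atTop (nhds 0) := by
    simpa using (tendsto_one_div_add_atTop_nhds_zero_nat (𝕜 := ℝ)).sqrt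
  simpa using (this.const_mul K).const_add (entropyForm r (∫ w, U w ∂μ) (∫ w, V w ∂μ))

end Averaging

section SmoothFunctions

open Filter Topology
open scoped ContDiff

variable {E : Type*} [NormedAddCommGroup E] [NormedSpace ℝ E] [FiniteDimensional ℝ E]

lemma exists_smoothAlong_exp {W : Type*} [NormedAddCommGroup W] [NormedSpace ℝ W]
    [MeasurableSpace W] [BorelSpace W] [SecondCountableTopology W] (L : W →L[ℝ] E) {f : E → ℝ}
    {M : ℝ} (hf : ContDiff ℝ ∞ f) (hfc : HasCompactSupport f) (hfM : ∀ x, |f x| ≤ M) :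
    ∃ C, SmoothAlong L (Real.exp (-M)) (Real.exp M) C (fun w => Real.exp (f (L w)))
      (fun w => fderiv ℝ (fun x => Real.exp (f x) - 1) (L w)) := by
  set F : E → ℝ := fun x => Real.exp (f x) - 1 with hF
  have hFs : ContDiff ℝ ∞ F := by fun_prop
  have hFc : HasCompactSupport F := hfc.comp_left (g := fun y => Real.exp y - 1) (by simp)
  have hF's : ContDiff ℝ 1 (fderiv ℝ F) := hFs.fderiv_right (by norm_cast)
  obtain ⟨C₀, hC₀⟩ := (hFc.fderiv ℝ).exists_bound_of_continuous hF's.continuous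
  obtain ⟨K, hK⟩ := hF's.lipschitzWith_of_hasCompactSupport (hFc.fderiv ℝ) one_ne_zero
  have hC₀' : 0 ≤ C₀ := (norm_nonneg _).trans (hC₀ 0)
  have hdiff : ∀ x, DifferentiableAt ℝ F x := fun x => hFs.differentiable (by simp) x
  have hsub : ∀ x y, Real.exp (f y) - Real.exp (f x) = F y - F x := fun x y => by simp [hF]
  have lip : ∀ x y, |F y - F x| ≤ C₀ * ‖y - x‖ := fun x y =>
    convex_univ.norm_image_sub_le_of_norm_fderiv_le (fun z _ => hdiff z) (fun z _ => hC₀ z)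
      (Set.mem_univ x) (Set.mem_univ y)
  have tay : ∀ x y, |F y - F x - fderiv ℝ F x (y - x)| ≤ K * ‖y - x‖ ^ 2 := fun x y => by
    have := (convex_segment x y).norm_image_sub_le_of_norm_fderiv_le' (𝕜 := ℝ) (f := F)
      (φ := fderiv ℝ F x) (C := K * ‖y - x‖) (fun z _ => hdiff z) (fun z hz => ?_)
      (left_mem_segment ℝ x y) (right_mem_segment ℝ x y)
    · rwa [mul_assoc, ← pow_two] at this
    · refine (hK.norm_sub_le z x).trans ?_
      gcongr
      exact norm_sub_le_of_mem_segment hz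
  have hL := norm_nonneg L
  refine ⟨C₀ + C₀ * ‖L‖ + K * ‖L‖ ^ 2, ⟨?_, ?_, ?_, ?_, ?_, ?_⟩⟩
  · exact (Real.continuous_exp.comp (hf.continuous.comp L.continuous)).measurable
  · exact fun w => ⟨Real.exp_le_exp.2 (abs_le.1 (hfM _)).1,
      Real.exp_le_exp.2 (abs_le.1 (hfM _)).2⟩
  · exact (hF's.continuous.comp L.continuous).stronglyMeasurable
  · intro w
    have : 0 ≤ C₀ * ‖L‖ + K * ‖L‖ ^ 2 := by positivity
    linarith [hC₀ (L w)]
  · intro w h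
    rw [hsub]
    have h1 := lip (L w) (L (w + h))
    rw [map_add, add_sub_cancel_left] at h1
    have h2 : C₀ * ‖L h‖ ≤ C₀ * (‖L‖ * ‖h‖) := by gcongr; exact L.le_opNorm h
    have h3 : 0 ≤ (C₀ + K * ‖L‖ ^ 2) * ‖h‖ := by positivity
    rw [map_add]
    linarith
  · intro w h
    rw [hsub]
    have h1 := tay (L w) (L (w + h))
    rw [map_add, add_sub_cancel_left] at h1
    have h2 : K * ‖L h‖ ^ 2 ≤ K * (‖L‖ * ‖h‖) ^ 2 := by gcongr; exact L.le_opNorm h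
    have h3 : 0 ≤ (C₀ + C₀ * ‖L‖) * ‖h‖ ^ 2 := by positivity
    rw [map_add]
    linarith

variable [MeasurableSpace E] [BorelSpace E]

lemma exists_contDiff_hasCompactSupport_tendsto_ae (γ : Measure E) [IsFiniteMeasure γ]
    {f : E → ℝ} {M : ℝ} (hf : Measurable f) (hM : ∀ x, |f x| ≤ M) :
    ∃ φ : ℕ → E → ℝ, (∀ n, ContDiff ℝ ∞ (φ n)) ∧ (∀ n, HasCompactSupport (φ n)) ∧
      (∀ n x, |φ n x| ≤ M + 2) ∧ ∀ᵐ x ∂γ, Tendsto (fun n => φ n x) atTop (𝓝 (f x)) := by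
  have hM0 : 0 ≤ M := (abs_nonneg _).trans (hM 0)
  have hfL : MemLp f 1 γ := MemLp.of_bound hf.aestronglyMeasurable M (ae_of_all _ hM)
  choose ψ hψc hψs hψ using fun n : ℕ =>
    hfL.exist_eLpNorm_sub_le (by simp) le_rfl (Nat.one_div_pos_of_nat (n := n) (α := ℝ))
  have hlim : Tendsto (fun n => eLpNorm (ψ n - f) 1 γ) atTop (𝓝 0) := by
    have h0 : Tendsto (fun n : ℕ => ENNReal.ofReal (1 / ((n : ℝ) + 1))) atTop (𝓝 0) := by
      simpa using ENNReal.tendsto_ofReal (tendsto_one_div_add_atTop_nhds_zero_nat (𝕜 := ℝ))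
    refine tendsto_of_tendsto_of_tendsto_of_le_of_le tendsto_const_nhds h0 (fun _ => zero_le)
      fun n => ?_
    rw [eLpNorm_sub_comm]
    exact hψ n
  obtain ⟨ns, -, hns⟩ := (tendstoInMeasure_of_tendsto_eLpNorm one_ne_zero
    (fun n => (hψs n).continuous.aestronglyMeasurable) hf.aestronglyMeasurable
    hlim).exists_seq_tendsto_ae
  let χ : ContDiffBump (0 : ℝ) := ⟨M + 1, M + 2, by linarith, by linarith⟩
  have hχs : ContDiff ℝ ∞ fun y : ℝ => χ y * y := χ.contDiff.mul contDiff_id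
  have hχf : ∀ x, χ (f x) * f x = f x := fun x => by
    rw [χ.one_of_mem_closedBall, one_mul]
    simpa using (hM x).trans (by simp [χ])
  refine ⟨fun n x => χ (ψ (ns n) x) * ψ (ns n) x, fun n => hχs.comp (hψs _),
    fun n => (hψc _).comp_left (g := fun y => χ y * y) (by simp), fun n x => ?_, ?_⟩
  · dsimp only
    rcases le_or_gt (M + 2) |ψ (ns n) x| with h | h
    · rw [χ.zero_of_le_dist (by simpa [χ] using h)]
      simp
      linarith
    · rw [abs_mul, abs_of_nonneg χ.nonneg]
      exact (mul_le_mul χ.le_one h.le (abs_nonneg _) zero_le_one).trans (by simp)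
  · filter_upwards [hns] with x hx
    have := (hχs.continuous.tendsto (f x)).comp hx
    rwa [hχf] at this

end SmoothFunctions

section Correlated

open Filter Topology
open scoped ContDiff

variable {E : Type*} [NormedAddCommGroup E] [NormedSpace ℝ E] [MeasurableSpace E] [BorelSpace E]
  [SecondCountableTopology E] [CompleteSpace E] {γ : Measure E} [IsGaussian γ] {ρ σ : ℝ}

lemma measurePreserving_smul_add_smul (hγ : ∫ x, x ∂γ = 0) (hρσ : ρ ^ 2 + σ ^ 2 = 1) :
    MeasurePreserving (fun p : E × E => ρ • p.1 + σ • p.2) (γ.prod γ) γ :=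
  ⟨by fun_prop, map_add_smul_prod_eq hγ hρσ⟩

lemma integral_covariance_form_nonpos (hγ : ∫ x, x ∂γ = 0) (hρσ : ρ ^ 2 + σ ^ 2 = 1)
    (ℓ k : StrongDual ℝ E) :
    ∫ p : E × E, (ℓ p.1 * k (ρ • p.1 + σ • p.2) - k (ρ • p.1 + σ • p.2) ^ 2 / 2
      - ρ ^ 2 * ℓ p.1 ^ 2 / 2) ∂(γ.prod γ) ≤ 0 := by
  have hmp := measurePreserving_smul_add_smul hγ hρσ
  have hfst : MeasurePreserving Prod.fst (γ.prod γ) γ := measurePreserving_fst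
  have mℓ : MemLp ℓ 2 γ := IsGaussian.memLp_dual γ ℓ 2 (by simp)
  have mk : MemLp k 2 γ := IsGaussian.memLp_dual γ k 2 (by simp)
  have mℓ' : MemLp (fun p : E × E => ℓ p.1) 2 (γ.prod γ) := mℓ.comp_measurePreserving hfst
  have mk' : MemLp (fun p : E × E => k (ρ • p.1 + σ • p.2)) 2 (γ.prod γ) :=
    mk.comp_measurePreserving hmp
  have i₁ : Integrable (fun p : E × E => ℓ p.1 * k (ρ • p.1 + σ • p.2)) (γ.prod γ) :=
    mℓ'.integrable_mul mk'
  have i₂ : Integrable (fun p : E × E => k (ρ • p.1 + σ • p.2) ^ 2 / 2) (γ.prod γ) :=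
    mk'.integrable_sq.div_const 2
  have i₃ : Integrable (fun p : E × E => ρ ^ 2 * ℓ p.1 ^ 2 / 2) (γ.prod γ) :=
    (mℓ'.integrable_sq.const_mul _).div_const 2
  have i₁₂ : Integrable (fun p : E × E => ℓ p.1 * k (ρ • p.1 + σ • p.2)
      - k (ρ • p.1 + σ • p.2) ^ 2 / 2) (γ.prod γ) := i₁.sub i₂
  have iℓk : Integrable (fun x => ℓ x * k x) γ := mℓ.integrable_mul mk
  have e₁ : ∫ p : E × E, ℓ p.1 * k (ρ • p.1 + σ • p.2) ∂(γ.prod γ) = ρ * ∫ x, ℓ x * k x ∂γ := by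
    have j₁ : Integrable (fun p : E × E => ρ * (ℓ p.1 * k p.1)) (γ.prod γ) :=
      (hfst.integrable_comp_of_integrable iℓk).const_mul ρ
    have j₂ : Integrable (fun p : E × E => σ * (ℓ p.1 * k p.2)) (γ.prod γ) :=
      ((IsGaussian.integrable_dual γ ℓ).mul_prod (IsGaussian.integrable_dual γ k)).const_mul σ
    have k0 : ∫ x, k x ∂γ = 0 := by
      simpa [hγ] using IsGaussian.integral_dual (μ := γ) k
    calc ∫ p : E × E, ℓ p.1 * k (ρ • p.1 + σ • p.2) ∂(γ.prod γ)
        = ∫ p : E × E, (ρ * (ℓ p.1 * k p.1) + σ * (ℓ p.1 * k p.2)) ∂(γ.prod γ) := by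
          congr 1 with p
          simp only [map_add, map_smul, smul_eq_mul]
          ring
      _ = ρ * ∫ x, ℓ x * k x ∂γ := by
          rw [integral_add j₁ j₂, integral_const_mul, integral_const_mul,
            integral_prod_mul (fun x => ℓ x) (fun x => k x), k0,
            integral_fun_fst (fun x => ℓ x * k x)]
          simp
  have e₂ : ∫ p : E × E, k (ρ • p.1 + σ • p.2) ^ 2 / 2 ∂(γ.prod γ) = ∫ x, k x ^ 2 / 2 ∂γ := by
    conv_rhs => rw [← hmp.map_eq]
    rw [integral_map hmp.aemeasurable (by fun_prop)]
  have e₃ : ∫ p : E × E, ρ ^ 2 * ℓ p.1 ^ 2 / 2 ∂(γ.prod γ) = ∫ x, ρ ^ 2 * ℓ x ^ 2 / 2 ∂γ := by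
    rw [integral_fun_fst (fun x => ρ ^ 2 * ℓ x ^ 2 / 2)]
    simp
  have ik : Integrable (fun x => k x ^ 2 / 2) γ := mk.integrable_sq.div_const 2
  have iℓ : Integrable (fun x => ρ ^ 2 * ℓ x ^ 2 / 2) γ :=
    (mℓ.integrable_sq.const_mul _).div_const 2
  have h := integral_mono (iℓk.const_mul ρ) (ik.add iℓ) fun x => by
    simp only [Pi.add_apply]
    linarith [sq_nonneg (ρ * ℓ x - k x)]
  have h' := integral_add ik iℓ
  rw [integral_const_mul] at h
  rw [integral_sub i₁₂ i₃, integral_sub i₁ i₂, e₁, e₂, e₃]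
  simp only [Pi.add_apply] at h
  linarith

variable [FiniteDimensional ℝ E]

lemma integral_id_prod_eq_zero (hγ : ∫ x, x ∂γ = 0) : ∫ p : E × E, p ∂(γ.prod γ) = 0 := by
  have hi : Integrable (fun p : E × E => p) (γ.prod γ) :=
    IsGaussian.integrable_id
  refine Prod.ext ?_ ?_
  · rw [fst_integral hi, integral_fun_fst (fun x => x)]
    simp [hγ]
  · rw [snd_integral hi, integral_fun_snd (fun x => x)]
    simp [hγ]

lemma integral_entropyForm_exp_le_of_contDiff (hγ : ∫ x, x ∂γ = 0) (hρσ : ρ ^ 2 + σ ^ 2 = 1)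
    {f g : E → ℝ} {M : ℝ} (hf : ContDiff ℝ ∞ f) (hg : ContDiff ℝ ∞ g) (hfc : HasCompactSupport f)
    (hgc : HasCompactSupport g) (hfM : ∀ x, |f x| ≤ M) (hgM : ∀ x, |g x| ≤ M) :
    ∫ p : E × E, entropyForm (ρ ^ 2) (Real.exp (g p.1)) (Real.exp (f (ρ • p.1 + σ • p.2)))
        ∂(γ.prod γ)
      ≤ entropyForm (ρ ^ 2) (∫ x, Real.exp (g x) ∂γ) (∫ x, Real.exp (f x) ∂γ) := by
  have hmp := measurePreserving_smul_add_smul hγ hρσ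
  obtain ⟨C₁, h₁⟩ := exists_smoothAlong_exp (ContinuousLinearMap.fst ℝ E E) hg hgc hgM
  obtain ⟨C₂, h₂⟩ := exists_smoothAlong_exp (ρ • ContinuousLinearMap.fst ℝ E E
    + σ • ContinuousLinearMap.snd ℝ E E) hf hfc hfM
  have h := integral_entropyForm_le_of_smoothAlong (μ := γ.prod γ) (r := ρ ^ 2)
    (integral_id_prod_eq_zero hγ) (Real.exp_pos _)
    ((norm_nonneg _).trans ((h₁.norm_le 0).trans (le_max_left C₁ C₂))) (sq_nonneg ρ)
    (by nlinarith [sq_nonneg σ]) (integral_covariance_form_nonpos hγ hρσ)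
    (h₁.mono (le_max_left _ _)) (h₂.mono (le_max_right _ _))
  have e₁ : ∫ p : E × E, Real.exp (g p.1) ∂(γ.prod γ) = ∫ x, Real.exp (g x) ∂γ := by
    rw [integral_fun_fst (fun x => Real.exp (g x))]
    simp
  have e₂ : ∫ p : E × E, Real.exp (f (ρ • p.1 + σ • p.2)) ∂(γ.prod γ)
      = ∫ x, Real.exp (f x) ∂γ := by
    have := hf.continuous
    conv_rhs => rw [← hmp.map_eq]
    rw [integral_map hmp.aemeasurable (by fun_prop)]
  rw [← e₁, ← e₂]
  exact h

end Correlated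

section Hypercontractivity

open Filter Topology

variable {E : Type*} [NormedAddCommGroup E] [NormedSpace ℝ E] [FiniteDimensional ℝ E]
  [MeasurableSpace E] [BorelSpace E] {γ : Measure E} [IsGaussian γ] {ρ σ : ℝ}

lemma exp_mem_Icc_of_abs_le {y M : ℝ} (h : |y| ≤ M) :
    Real.exp y ∈ Set.Icc (Real.exp (-M)) (Real.exp M) :=
  ⟨Real.exp_le_exp.2 (abs_le.1 h).1, Real.exp_le_exp.2 (abs_le.1 h).2⟩

lemma tendsto_integral_exp {Ω : Type*} [MeasurableSpace Ω] {μ : Measure Ω} [IsFiniteMeasure μ]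
    {f : Ω → ℝ} {φ : ℕ → Ω → ℝ} {M : ℝ} (hφ : ∀ n, Measurable (φ n)) (hM : ∀ n x, |φ n x| ≤ M)
    (h : ∀ᵐ x ∂μ, Tendsto (fun n => φ n x) atTop (𝓝 (f x))) :
    Tendsto (fun n => ∫ x, Real.exp (φ n x) ∂μ) atTop (𝓝 (∫ x, Real.exp (f x) ∂μ)) := by
  refine tendsto_integral_of_dominated_convergence (fun _ => Real.exp M)
    (fun n => (hφ n).exp.aestronglyMeasurable) (integrable_const _)
    (fun n => ae_of_all _ fun x => ?_) ?_
  · rw [Real.norm_eq_abs, Real.abs_exp]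
    exact (exp_mem_Icc_of_abs_le (hM n x)).2
  · filter_upwards [h] with x hx using hx.rexp

lemma Filter.Tendsto.entropyForm {ι : Type*} {l : Filter ι} {r u v : ℝ} {U V : ι → ℝ}
    (hU : Tendsto U l (𝓝 u)) (hV : Tendsto V l (𝓝 v)) (hv : 0 < v) (hu : 0 < u) :
    Tendsto (fun i => _root_.entropyForm r (U i) (V i)) l (𝓝 (_root_.entropyForm r u v)) :=
  (hU.mul (hV.log hv.ne')).sub ((hU.mul (hU.log hu.ne')).const_mul r)

lemma integral_exp_pos_of_abs_le {Ω : Type*} [MeasurableSpace Ω] {μ : Measure Ω}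
    [IsProbabilityMeasure μ] {f : Ω → ℝ} {M : ℝ} (hf : Measurable f) (hM : ∀ x, |f x| ≤ M) :
    0 < ∫ x, Real.exp (f x) ∂μ :=
  (Real.exp_pos _).trans_le
    (integral_mem_Icc hf.exp fun x => exp_mem_Icc_of_abs_le (hM x)).1

lemma integral_entropyForm_exp_le_of_bounded (hγ : ∫ x, x ∂γ = 0) (hρσ : ρ ^ 2 + σ ^ 2 = 1)
    {f g : E → ℝ} {M : ℝ} (hf : Measurable f) (hg : Measurable g)
    (hfM : ∀ x, |f x| ≤ M) (hgM : ∀ x, |g x| ≤ M) :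
    ∫ p : E × E, entropyForm (ρ ^ 2) (Real.exp (g p.1)) (Real.exp (f (ρ • p.1 + σ • p.2)))
        ∂(γ.prod γ)
      ≤ entropyForm (ρ ^ 2) (∫ x, Real.exp (g x) ∂γ) (∫ x, Real.exp (f x) ∂γ) := by
  have hmp := measurePreserving_smul_add_smul hγ hρσ
  obtain ⟨φ, hφ, hφc, hφM, hφt⟩ := exists_contDiff_hasCompactSupport_tendsto_ae γ hf hfM
  obtain ⟨ψ, hψ, hψc, hψM, hψt⟩ := exists_contDiff_hasCompactSupport_tendsto_ae γ hg hgM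
  have mφ n : Measurable (φ n) := (hφ n).continuous.measurable
  have mψ n : Measurable (ψ n) := (hψ n).continuous.measurable
  obtain ⟨K, hK⟩ := entropyForm_mem_Icc (b := Real.exp (M + 2)) (Real.exp_pos (-(M + 2)))
    (sq_nonneg ρ) (by nlinarith [sq_nonneg σ])
  refine le_of_tendsto_of_tendsto' (b := atTop) ?_ ?_ fun n =>
    integral_entropyForm_exp_le_of_contDiff hγ hρσ (hφ n) (hψ n) (hφc n) (hψc n) (hφM n) (hψM n)
  · refine tendsto_integral_of_dominated_convergence (fun _ => K) (fun n => ?_)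
      (integrable_const _) (fun n => ae_of_all _ fun p => ?_) ?_
    · exact (((mψ n).comp measurable_fst).exp.entropyForm
        ((mφ n).comp hmp.measurable).exp).aestronglyMeasurable
    · exact abs_le.2 (hK _ (exp_mem_Icc_of_abs_le (hψM n _)) _ (exp_mem_Icc_of_abs_le (hφM n _)))
    · filter_upwards [hmp.quasiMeasurePreserving.ae hφt,
        measurePreserving_fst.quasiMeasurePreserving.ae hψt] with p h₁ h₂
      exact h₂.rexp.entropyForm h₁.rexp (Real.exp_pos _) (Real.exp_pos _)
  · exact (tendsto_integral_exp mψ hψM hψt).entropyForm (tendsto_integral_exp mφ hφM hφt)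
      (integral_exp_pos_of_abs_le hf hfM) (integral_exp_pos_of_abs_le hg hgM)

lemma measurable_integral_smul_add_smul {f : E → ℝ} (hf : Measurable f) :
    Measurable fun x => ∫ y, f (ρ • x + σ • y) ∂γ := by
  have h : Measurable fun p : E × E => f (ρ • p.1 + σ • p.2) := by fun_prop
  exact h.stronglyMeasurable.integral_prod_right.measurable

lemma integral_exp_integral_le_of_bounded (hγ : ∫ x, x ∂γ = 0) (hρσ : ρ ^ 2 + σ ^ 2 = 1)
    (hρ : ρ ≠ 0) {f : E → ℝ} {M : ℝ} (hf : Measurable f) (hfM : ∀ x, |f x| ≤ M) :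
    ∫ x, Real.exp ((ρ ^ 2)⁻¹ * ∫ y, f (ρ • x + σ • y) ∂γ) ∂γ
      ≤ (∫ x, Real.exp (f x) ∂γ) ^ (ρ ^ 2)⁻¹ := by
  have hρ2 : 0 < ρ ^ 2 := by positivity
  have hρ1 : ρ ^ 2 ≤ 1 := by nlinarith [sq_nonneg σ]
  have hM : 0 ≤ M := (abs_nonneg _).trans (hfM 0)
  have hc : 1 ≤ (ρ ^ 2)⁻¹ := (one_le_inv₀ hρ2).2 hρ1
  set g : E → ℝ := fun x => (ρ ^ 2)⁻¹ * ∫ y, f (ρ • x + σ • y) ∂γ with hg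
  have mg : Measurable g := (measurable_integral_smul_add_smul hf).const_mul _
  have mF : Measurable fun p : E × E => f (ρ • p.1 + σ • p.2) := by fun_prop
  have hgM x : |g x| ≤ (ρ ^ 2)⁻¹ * M := by
    rw [hg, abs_mul, abs_of_pos (inv_pos.2 hρ2)]
    gcongr
    have := integral_mem_Icc (μ := γ) (f := fun y => f (ρ • x + σ • y)) (by fun_prop)
      fun y => abs_le.1 (hfM (ρ • x + σ • y))
    exact abs_le.2 this
  have hfM' x : |f x| ≤ (ρ ^ 2)⁻¹ * M := (hfM x).trans (le_mul_of_one_le_left hM hc)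
  have key := integral_entropyForm_exp_le_of_bounded hγ hρσ hf mg hfM' hgM
  have hzero : ∫ p : E × E, entropyForm (ρ ^ 2) (Real.exp (g p.1))
      (Real.exp (f (ρ • p.1 + σ • p.2))) ∂(γ.prod γ) = 0 := by
    obtain ⟨K, hK⟩ := entropyForm_mem_Icc (b := Real.exp ((ρ ^ 2)⁻¹ * M))
      (Real.exp_pos (-((ρ ^ 2)⁻¹ * M))) hρ2.le hρ1
    have mg' : Measurable fun p : E × E => g p.1 := mg.comp measurable_fst
    rw [integral_prod _ (integrable_of_mem_Icc
      (mg'.exp.entropyForm mF.exp)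
      fun p => hK _ (exp_mem_Icc_of_abs_le (hgM _)) _ (exp_mem_Icc_of_abs_le (hfM' _)))]
    refine integral_eq_zero_of_ae (ae_of_all _ fun x => ?_)
    have hi : Integrable (fun y => f (ρ • x + σ • y)) γ :=
      integrable_of_mem_Icc (by fun_prop) fun y => abs_le.1 (hfM (ρ • x + σ • y))
    simp only [entropyForm, Real.log_exp, Pi.zero_apply]
    rw [integral_sub (hi.const_mul _) (integrable_const _), integral_const_mul, hg]
    simp
    field_simp
    ring
  have hA := integral_exp_pos_of_abs_le (μ := γ) mg hgM
  have hB := integral_exp_pos_of_abs_le (μ := γ) hf hfM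
  rw [hzero, entropyForm, sub_nonneg, mul_left_comm, mul_le_mul_iff_right₀ hA] at key
  rw [← Real.log_le_log_iff hA (by positivity), Real.log_rpow hB, le_inv_mul_iff₀ hρ2]
  exact key

lemma abs_max_neg_min_le_abs {M : ℝ} (hM : 0 ≤ M) (y : ℝ) : |max (-M) (min y M)| ≤ |y| := by
  have h := abs_nonneg y
  exact abs_le.2 ⟨le_max_of_le_right (le_min (neg_abs_le y) (by linarith)),
    max_le (by linarith) ((min_le_left _ _).trans (le_abs_self y))⟩

theorem integral_exp_integral_le (hγ : ∫ x, x ∂γ = 0) (hρσ : ρ ^ 2 + σ ^ 2 = 1)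
    (hρ : ρ ≠ 0) {f : E → ℝ} (hf : Measurable f) (hfi : Integrable f γ)
    (hfe : Integrable (fun x => Real.exp (f x)) γ) :
    ∫ x, Real.exp ((ρ ^ 2)⁻¹ * ∫ y, f (ρ • x + σ • y) ∂γ) ∂γ
      ≤ (∫ x, Real.exp (f x) ∂γ) ^ (ρ ^ 2)⁻¹ := by
  have hρ2 : 0 < ρ ^ 2 := by positivity
  have hmp := measurePreserving_smul_add_smul hγ hρσ
  set φ : ℕ → E → ℝ := fun n x => max (-(n : ℝ)) (min (f x) n) with hφ
  have mφ n : Measurable (φ n) := measurable_const.max (hf.min measurable_const)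
  have bφ n x : |φ n x| ≤ n :=
    abs_le.2 ⟨le_max_left _ _, max_le (by simp) (min_le_right _ _)⟩
  have bφ' n x : |φ n x| ≤ |f x| := abs_max_neg_min_le_abs n.cast_nonneg (f x)
  have tφ x : Tendsto (fun n => φ n x) atTop (𝓝 (f x)) := by
    refine tendsto_const_nhds.congr' ?_
    filter_upwards [eventually_ge_atTop ⌈|f x|⌉₊] with n hn
    have := abs_le.1 (Nat.ceil_le.1 hn)
    simp [hφ, this.1, this.2]
  have hQ : ∀ᵐ x ∂γ, Tendsto (fun n => ∫ y, φ n (ρ • x + σ • y) ∂γ) atTop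
      (𝓝 (∫ y, f (ρ • x + σ • y) ∂γ)) := by
    have hi : Integrable (fun p : E × E => f (ρ • p.1 + σ • p.2)) (γ.prod γ) :=
      hmp.integrable_comp_of_integrable hfi
    filter_upwards [hi.prod_right_ae] with x hx
    refine tendsto_integral_of_dominated_convergence _ (fun n => ?_) hx.norm
      (fun n => ae_of_all _ fun y => bφ' n _) (ae_of_all _ fun y => tφ _)
    have := mφ n
    exact (by fun_prop : Measurable fun y => φ n (ρ • x + σ • y)).aestronglyMeasurable
  have hB : Tendsto (fun n => ∫ x, Real.exp (φ n x) ∂γ) atTop (𝓝 (∫ x, Real.exp (f x) ∂γ)) := by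
    refine tendsto_integral_of_dominated_convergence (fun x => Real.exp (f x) + 1)
      (fun n => (mφ n).exp.aestronglyMeasurable) (hfe.add (integrable_const 1))
      (fun n => ae_of_all _ fun x => ?_) (ae_of_all _ fun x => (tφ x).rexp)
    rw [Real.norm_eq_abs, Real.abs_exp]
    have h : φ n x ≤ max 0 (f x) :=
      max_le (le_max_of_le_left (by simp)) (le_max_of_le_right (min_le_left _ _))
    refine (Real.exp_le_exp.2 h).trans ?_
    rcases max_cases 0 (f x) with h | h <;> rw [h.1]
    · simp [Real.exp_nonneg]
    · simp
  have mQ {h : E → ℝ} (hh : Measurable h) :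
      Measurable fun x => Real.exp ((ρ ^ 2)⁻¹ * ∫ y, h (ρ • x + σ • y) ∂γ) :=
    ((measurable_integral_smul_add_smul hh).const_mul _).exp
  rw [integral_eq_lintegral_of_nonneg_ae (ae_of_all _ fun x => Real.exp_nonneg _)
    (mQ hf).aestronglyMeasurable]
  refine ENNReal.toReal_le_of_le_ofReal (by positivity) ?_
  calc ∫⁻ x, ENNReal.ofReal (Real.exp ((ρ ^ 2)⁻¹ * ∫ y, f (ρ • x + σ • y) ∂γ)) ∂γ
      = ∫⁻ x, liminf (fun n => ENNReal.ofReal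
          (Real.exp ((ρ ^ 2)⁻¹ * ∫ y, φ n (ρ • x + σ • y) ∂γ))) atTop ∂γ := by
        refine lintegral_congr_ae ?_
        filter_upwards [hQ] with x hx
        exact (ENNReal.tendsto_ofReal (hx.const_mul _).rexp).liminf_eq.symm
    _ ≤ liminf (fun n => ∫⁻ x, ENNReal.ofReal
          (Real.exp ((ρ ^ 2)⁻¹ * ∫ y, φ n (ρ • x + σ • y) ∂γ)) ∂γ) atTop :=
        lintegral_liminf_le fun n => (mQ (mφ n)).ennreal_ofReal
    _ ≤ liminf (fun n => ENNReal.ofReal ((∫ x, Real.exp (φ n x) ∂γ) ^ (ρ ^ 2)⁻¹)) atTop := by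
        refine liminf_le_liminf (Eventually.of_forall fun n => ?_)
        have hi : Integrable (fun x => Real.exp ((ρ ^ 2)⁻¹ * ∫ y, φ n (ρ • x + σ • y) ∂γ)) γ := by
          refine integrable_of_mem_Icc (mQ (mφ n)) fun x => exp_mem_Icc_of_abs_le
            (M := (ρ ^ 2)⁻¹ * n) ?_
          rw [abs_mul, abs_of_pos (inv_pos.2 hρ2)]
          gcongr
          have := mφ n
          exact abs_le.2 (integral_mem_Icc (μ := γ) (by fun_prop) fun y => abs_le.1 (bφ n _))
        rw [← ofReal_integral_eq_lintegral_ofReal hi (ae_of_all _ fun x => Real.exp_nonneg _)]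
        exact ENNReal.ofReal_le_ofReal
          (integral_exp_integral_le_of_bounded hγ hρσ hρ (mφ n) (bφ n))
    _ = ENNReal.ofReal ((∫ x, Real.exp (f x) ∂γ) ^ (ρ ^ 2)⁻¹) :=
        (ENNReal.tendsto_ofReal (hB.rpow_const (Or.inr (by positivity)))).liminf_eq

end Hypercontractivity

lemma isGaussian_stdGaussian_and_integral_id (d : ℕ) :
    IsGaussian (_root_.stdGaussian d) ∧ ∫ x, x ∂(_root_.stdGaussian d) = 0 := by
  rw [show _root_.stdGaussian d = ProbabilityTheory.stdGaussian (EuclideanSpace ℝ (Fin d)) from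
    map_pi_eq_stdGaussian]
  exact ⟨inferInstance, integral_id_stdGaussian⟩

/-- **Exponential hypercontractivity of the Ornstein–Uhlenbeck semigroup** (inequality
(3.2)): for measurable `f` with `e^f ∈ L¹(γ)` and `f ∈ L¹(γ)`,
`‖exp(Q_t f)‖_{L^{e^{2t}}(γ)} ≤ ‖e^f‖_{L¹(γ)}` for all `t ≥ 0`. -/
theorem ou_exponential_hypercontractivity {d : ℕ} (f : Ed d → ℝ) (hf : Measurable f)
    (hfe : Integrable (fun x => Real.exp (f x)) (stdGaussian d))
    (hf1 : Integrable f (stdGaussian d)) (t : ℝ) (ht : 0 ≤ t) :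
    (∫ x, Real.exp (Real.exp (2*t) * OUsg t f x) ∂(stdGaussian d)) ^ (Real.exp (2*t))⁻¹
      ≤ ∫ x, Real.exp (f x) ∂(stdGaussian d) := by
  obtain ⟨hG, h0⟩ := isGaussian_stdGaussian_and_integral_id d
  have h2 : Real.exp (-t) ^ 2 = Real.exp (-2 * t) := by
    rw [← Real.exp_nat_mul]
    ring_nf
  have hσ : 0 ≤ 1 - Real.exp (-2 * t) := sub_nonneg.2 (Real.exp_le_one_iff.2 (by linarith))
  have h := integral_exp_integral_le (σ := √(1 - Real.exp (-2 * t))) h0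
    (by rw [Real.sq_sqrt hσ, h2]; ring) (Real.exp_ne_zero (-t)) hf hf1 hfe
  rw [h2, ← Real.exp_neg, neg_mul, neg_neg] at h
  refine (Real.rpow_inv_le_iff_of_pos ?_ ?_ (Real.exp_pos _)).2 ?_
  · exact integral_nonneg fun x => Real.exp_nonneg _
  · exact integral_nonneg fun x => Real.exp_nonneg _
  · simpa only [OUsg, neg_mul] using h
end
end

section
/- The Gaussian logarithmic Sobolev inequality: for any weakly differentiable f ∈ L^2(γ) with |∇f| ∈ L^2(γ), ∫_{ℝ^d} |f|^2 log|f| dγ ≤ ‖|∇f|‖²_{L^2(γ)} + ‖f‖²_{L^2(γ)} log ‖f‖_{L^2(γ)}. -/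
open MeasureTheory ProbabilityTheory
open scoped ENNReal NNReal

noncomputable section

/-- `g` is the weak gradient of `f` (against smooth compactly supported test functions,
with respect to Lebesgue measure). -/
def IsWeakGradient {d : ℕ} (f : Ed d → ℝ) (g : Ed d → Ed d) : Prop :=
  ∀ φ : Ed d → ℝ, ContDiff ℝ (⊤ : ℕ∞) φ → HasCompactSupport φ →
    (∫ x, f x • gradient φ x ∂(volume : Measure (Ed d)))
      = -∫ x, φ x • g x ∂(volume : Measure (Ed d))

section GaussianDensity

variable {E : Type*} [NormedAddCommGroup E] [InnerProductSpace ℝ E]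

/-- The density of the standard Gaussian measure with respect to Lebesgue measure. -/
def gaussianDensity (x : E) : ℝ :=
  (2 * Real.pi) ^ (-(Module.finrank ℝ E : ℝ) / 2) * Real.exp (-‖x‖ ^ 2 / 2)

lemma gaussianDensity_pos (x : E) : 0 < gaussianDensity x := by
  unfold gaussianDensity; positivity

lemma gaussianDensity_neg (x : E) : gaussianDensity (-x) = gaussianDensity x := by
  simp [gaussianDensity]

lemma hasFDerivAt_gaussianDensity (x : E) :
    HasFDerivAt (gaussianDensity (E := E)) (-(gaussianDensity x) • innerSL ℝ x) x := by
  have h1 : HasFDerivAt (fun y : E => -‖y‖ ^ 2 / 2) (-(innerSL ℝ x)) x := by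
    have h := ((hasStrictFDerivAt_norm_sq x).hasFDerivAt).const_mul (-(1 / 2 : ℝ))
    refine (h.congr_of_eventuallyEq (.of_forall fun y => by ring)).congr_fderiv ?_
    ext y; simp
  have h2 := (h1.exp).const_mul ((2 * Real.pi) ^ (-(Module.finrank ℝ E : ℝ) / 2))
  refine h2.congr_fderiv ?_
  ext y
  simp [gaussianDensity]
  ring

lemma continuous_gaussianDensity : Continuous (gaussianDensity (E := E)) := by
  unfold gaussianDensity; fun_prop

lemma gaussianDensity_le (x : E) :
    gaussianDensity x ≤ (2 * Real.pi) ^ (-(Module.finrank ℝ E : ℝ) / 2) := by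
  refine mul_le_of_le_one_right (by positivity) (Real.exp_le_one_iff.2 ?_)
  have := sq_nonneg ‖x‖
  linarith

lemma bddAbove_range_norm_gaussianDensity :
    BddAbove (Set.range fun x : E => ‖gaussianDensity x‖) := by
  refine ⟨(2 * Real.pi) ^ (-(Module.finrank ℝ E : ℝ) / 2), Set.forall_mem_range.2 fun x => ?_⟩
  rw [Real.norm_of_nonneg (gaussianDensity_pos x).le]
  exact gaussianDensity_le x

variable [FiniteDimensional ℝ E] [MeasurableSpace E] [BorelSpace E]

lemma integrable_gaussianDensity : Integrable (gaussianDensity (E := E)) := by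
  have h := (GaussianFourier.integrable_cexp_neg_mul_sq_norm_add (V := E) (b := 1 / 2)
    (by norm_num) 0 0).norm.const_mul ((2 * Real.pi) ^ (-(Module.finrank ℝ E : ℝ) / 2))
  refine h.congr (.of_forall fun x => ?_)
  simp only [gaussianDensity, Complex.norm_exp]
  congr 2
  have : (-(1 / 2 : ℂ) * (‖x‖ : ℂ) ^ 2 + 0 * ((inner ℝ (0 : E) x : ℝ) : ℂ))
      = ((-‖x‖ ^ 2 / 2 : ℝ) : ℂ) := by
    push_cast; ring
  rw [this, Complex.ofReal_re]

lemma charFun_withDensity_gaussianDensity (t : E) :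
    charFun ((volume : Measure E).withDensity fun x => ENNReal.ofReal (gaussianDensity x)) t
      = Complex.exp (-‖t‖ ^ 2 / 2) := by
  rw [charFun_apply, integral_withDensity_eq_integral_toReal_smul
    continuous_gaussianDensity.measurable.ennreal_ofReal (.of_forall fun x => by simp)]
  have h1 : ∀ x : E, (ENNReal.ofReal (gaussianDensity x)).toReal •
      Complex.exp ((inner ℝ x t : ℝ) * Complex.I)
      = (((2 * Real.pi) ^ (-(Module.finrank ℝ E : ℝ) / 2) : ℝ) : ℂ) *
        Complex.exp (-(1 / 2 : ℂ) * (‖x‖ : ℂ) ^ 2 + Complex.I * ((inner ℝ t x : ℝ) : ℂ)) := by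
    intro x
    rw [ENNReal.toReal_ofReal (gaussianDensity_pos x).le, gaussianDensity, Complex.real_smul,
      Complex.exp_add, real_inner_comm t x]
    push_cast
    rw [mul_assoc]
    congr 3
    · ring_nf
    · ring_nf
  simp_rw [h1]
  rw [integral_const_mul, GaussianFourier.integral_cexp_neg_mul_sq_norm_add (by norm_num)]
  have h2 : ((Real.pi : ℂ) / (1 / 2)) ^ ((Module.finrank ℝ E : ℂ) / 2)
      = (((2 * Real.pi) ^ ((Module.finrank ℝ E : ℝ) / 2) : ℝ) : ℂ) := by
    rw [Complex.ofReal_cpow (by positivity)]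
    push_cast
    congr 1
    ring
  rw [h2, ← mul_assoc, ← Complex.ofReal_mul, ← Real.rpow_add (by positivity)]
  rw [show -(Module.finrank ℝ E : ℝ) / 2 + (Module.finrank ℝ E : ℝ) / 2 = 0 by ring]
  rw [Real.rpow_zero, Complex.ofReal_one, one_mul, Complex.I_sq]
  congr 1
  ring

lemma stdGaussian_eq_withDensity :
    ProbabilityTheory.stdGaussian E
      = (volume : Measure E).withDensity fun x => ENNReal.ofReal (gaussianDensity x) := by
  have : IsFiniteMeasure
      ((volume : Measure E).withDensity fun x => ENNReal.ofReal (gaussianDensity x)) :=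
    isFiniteMeasure_withDensity_ofReal integrable_gaussianDensity.2
  refine Measure.ext_of_charFun (funext fun t => ?_)
  rw [charFun_withDensity_gaussianDensity, charFun_stdGaussian]

lemma integral_stdGaussian {F : Type*} [NormedAddCommGroup F] [NormedSpace ℝ F] (f : E → F) :
    ∫ x, f x ∂ProbabilityTheory.stdGaussian E = ∫ x, gaussianDensity x • f x := by
  rw [stdGaussian_eq_withDensity, integral_withDensity_eq_integral_toReal_smul
    continuous_gaussianDensity.measurable.ennreal_ofReal (.of_forall fun x => by simp)]
  simp_rw [ENNReal.toReal_ofReal (gaussianDensity_pos _).le]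

lemma integrable_stdGaussian_iff {F : Type*} [NormedAddCommGroup F] [NormedSpace ℝ F]
    {f : E → F} :
    Integrable f (ProbabilityTheory.stdGaussian E)
      ↔ Integrable fun x => gaussianDensity x • f x := by
  rw [stdGaussian_eq_withDensity, integrable_withDensity_iff_integrable_smul'
    continuous_gaussianDensity.measurable.ennreal_ofReal (.of_forall fun x => by simp)]
  simp_rw [ENNReal.toReal_ofReal (gaussianDensity_pos _).le]

lemma stdGaussian_absolutelyContinuous :
    ProbabilityTheory.stdGaussian E ≪ (volume : Measure E) := by
  rw [stdGaussian_eq_withDensity]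
  exact withDensity_absolutelyContinuous _ _

lemma volume_absolutelyContinuous_stdGaussian :
    (volume : Measure E) ≪ ProbabilityTheory.stdGaussian E := by
  rw [stdGaussian_eq_withDensity]
  exact withDensity_absolutelyContinuous'
    continuous_gaussianDensity.measurable.ennreal_ofReal.aemeasurable
    (.of_forall fun x => by simpa using gaussianDensity_pos x)

lemma integrable_norm_stdGaussian :
    Integrable (fun x : E => ‖x‖) (ProbabilityTheory.stdGaussian E) :=
  (IsGaussian.integrable_id (μ := ProbabilityTheory.stdGaussian E)).norm

lemma integrable_stdGaussian_of_bound {F : Type*} [NormedAddCommGroup F] {f : E → F}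
    (hf : Continuous f) {C : ℝ} (hC : ∀ x, ‖f x‖ ≤ C) :
    Integrable f (ProbabilityTheory.stdGaussian E) :=
  Integrable.of_bound hf.aestronglyMeasurable C (.of_forall hC)

/-- Gaussian integration by parts. -/
lemma integral_mul_inner_stdGaussian {F : E → ℝ} {F' : E → E} {A B : ℝ} (w : E)
    (hF : ∀ x, HasFDerivAt F (innerSL ℝ (F' x)) x) (hF' : Continuous F')
    (hA : ∀ x, |F x| ≤ A) (hB : ∀ x, ‖F' x‖ ≤ B) :
    ∫ x, F x * inner ℝ w x ∂ProbabilityTheory.stdGaussian E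
      = ∫ x, inner ℝ (F' x) w ∂ProbabilityTheory.stdGaussian E := by
  have hFc : Continuous F := continuous_iff_continuousAt.2 fun x => (hF x).continuousAt
  have i1 : Integrable (fun x => F x * inner ℝ w x) (ProbabilityTheory.stdGaussian E) := by
    refine (integrable_norm_stdGaussian.const_mul (A * ‖w‖)).mono' (by fun_prop)
      (.of_forall fun x => ?_)
    rw [norm_mul, mul_assoc]
    exact mul_le_mul (hA x) (norm_inner_le_norm w x) (norm_nonneg _)
      ((abs_nonneg _).trans (hA x))
  have i2 : Integrable (fun x => inner ℝ (F' x) w) (ProbabilityTheory.stdGaussian E) := by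
    refine integrable_stdGaussian_of_bound (by fun_prop) (C := B * ‖w‖) fun x => ?_
    exact (norm_inner_le_norm _ _).trans (by gcongr; exact hB x)
  have i3 : Integrable F (ProbabilityTheory.stdGaussian E) :=
    integrable_stdGaussian_of_bound hFc hA
  rw [integrable_stdGaussian_iff] at i1 i2 i3
  rw [integral_stdGaussian, integral_stdGaussian]
  have e1 : ∀ x, F x * fderiv ℝ (gaussianDensity (E := E)) x w
      = -(gaussianDensity x • (F x * inner ℝ w x)) := by
    intro x
    rw [(hasFDerivAt_gaussianDensity x).fderiv]
    simp [real_inner_comm]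
    ring
  have e2 : ∀ x, fderiv ℝ F x w * gaussianDensity x
      = gaussianDensity x • inner ℝ (F' x) w := by
    intro x
    rw [(hF x).fderiv]
    simp [mul_comm]
  have key := integral_mul_fderiv_eq_neg_fderiv_mul_of_integrable (μ := (volume : Measure E))
    (f := F) (g := gaussianDensity (E := E)) (v := w) (by simpa only [e2] using i2)
    (i1.neg.congr (.of_forall fun x => (e1 x).symm)) (by simpa [mul_comm] using i3)
    (fun x _ => (hF x).differentiableAt)
    (fun x _ => (hasFDerivAt_gaussianDensity x).differentiableAt)
  simp_rw [e1, e2, integral_neg] at key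
  exact neg_injective key

lemma integral_rotation_stdGaussian {f : E × E → ℝ} (hf : Continuous f) (θ : ℝ) :
    ∫ z, f (ContinuousLinearMap.rotation θ z)
        ∂(ProbabilityTheory.stdGaussian E).prod (ProbabilityTheory.stdGaussian E)
      = ∫ z, f z ∂(ProbabilityTheory.stdGaussian E).prod (ProbabilityTheory.stdGaussian E) := by
  conv_rhs => rw [← IsGaussian.map_rotation_eq_self_of_forall_strongDual_eq_zero
    (μ := ProbabilityTheory.stdGaussian E) (fun L => integral_strongDual_stdGaussian L) θ]
  rw [integral_map (by fun_prop) hf.aestronglyMeasurable]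

end GaussianDensity

section Mehler

lemma abs_inner_rotation_le {E : Type*} [NormedAddCommGroup E] [InnerProductSpace ℝ E]
    {G : E → E} {L : ℝ} (hL : ∀ x, ‖G x‖ ≤ L) (θ : ℝ) (x y : E) :
    |inner ℝ (G (Real.cos θ • x + Real.sin θ • y)) (-Real.sin θ • x + Real.cos θ • y)|
      ≤ L * (‖x‖ + ‖y‖) := by
  refine (abs_real_inner_le_norm _ _).trans ?_
  refine mul_le_mul (hL _) ((norm_add_le _ _).trans ?_) (norm_nonneg _)
    ((norm_nonneg _).trans (hL 0))
  rw [norm_smul, norm_smul, norm_neg]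
  exact add_le_add (mul_le_of_le_one_left (norm_nonneg _) (Real.abs_sin_le_one θ))
    (mul_le_of_le_one_left (norm_nonneg _) (Real.abs_cos_le_one θ))

lemma abs_log_le {m M u : ℝ} (hm : 0 < m) (h1 : m ≤ u) (h2 : u ≤ M) :
    |Real.log u| ≤ |Real.log m| + |Real.log M| := by
  have h3 := Real.log_le_log hm h1
  have h4 := Real.log_le_log (hm.trans_le h1) h2
  rw [abs_le]
  constructor
  · linarith [neg_abs_le (Real.log m), abs_nonneg (Real.log M)]
  · linarith [le_abs_self (Real.log M), abs_nonneg (Real.log m)]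

variable {E : Type*} [NormedAddCommGroup E] [InnerProductSpace ℝ E] [FiniteDimensional ℝ E]
  [MeasurableSpace E] [BorelSpace E]

/-- The Ornstein-Uhlenbeck semigroup, parametrised by an angle `θ` (`cos θ = exp (-t)`). -/
def mehler {F : Type*} [NormedAddCommGroup F] [NormedSpace ℝ F] (θ : ℝ) (h : E → F) (x : E) : F :=
  ∫ y, h (Real.cos θ • x + Real.sin θ • y) ∂ProbabilityTheory.stdGaussian E

lemma continuous_mehler {F : Type*} [NormedAddCommGroup F] [NormedSpace ℝ F] (θ : ℝ) {h : E → F}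
    (hc : Continuous h) {C : ℝ} (hC : ∀ x, ‖h x‖ ≤ C) : Continuous (mehler θ h) := by
  refine continuous_of_dominated (bound := fun _ => C)
    (fun x => Continuous.aestronglyMeasurable (by fun_prop))
    (fun x => .of_forall fun y => hC _) (integrable_const _) (.of_forall fun y => by fun_prop)

lemma norm_mehler_le {F : Type*} [NormedAddCommGroup F] [NormedSpace ℝ F] (θ : ℝ) {h : E → F}
    {C : ℝ} (hC : ∀ x, ‖h x‖ ≤ C) (x : E) : ‖mehler θ h x‖ ≤ C := by
  simpa [mehler] using norm_integral_le_of_norm_le_const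
    (μ := ProbabilityTheory.stdGaussian E) (.of_forall fun y => hC (Real.cos θ • x + Real.sin θ • y))

lemma le_mehler (θ : ℝ) {h : E → ℝ} (hc : Continuous h) {m C : ℝ} (hm : ∀ x, m ≤ h x)
    (hC : ∀ x, ‖h x‖ ≤ C) (x : E) : m ≤ mehler θ h x := by
  have := integral_mono (μ := ProbabilityTheory.stdGaussian E) (integrable_const m)
    (integrable_stdGaussian_of_bound (f := fun y => h (Real.cos θ • x + Real.sin θ • y))
      (by fun_prop) fun y => hC _) (fun y => hm _)
  simpa [mehler] using this

variable {h : E → ℝ} {G : E → E} {C L : ℝ}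

lemma hasFDerivAt_mehler (θ : ℝ) (hG : ∀ x, HasFDerivAt h (innerSL ℝ (G x)) x)
    (hGc : Continuous G) (hC : ∀ x, ‖h x‖ ≤ C) (hL : ∀ x, ‖G x‖ ≤ L) (x : E) :
    HasFDerivAt (mehler θ h) (innerSL ℝ (Real.cos θ • mehler θ G x)) x := by
  have hc : Continuous h := continuous_iff_continuousAt.2 fun x => (hG x).continuousAt
  have key := hasFDerivAt_integral_of_dominated_of_fderiv_le (𝕜 := ℝ)
    (μ := ProbabilityTheory.stdGaussian E) (x₀ := x) (s := Set.univ)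
    (F := fun x y => h (Real.cos θ • x + Real.sin θ • y))
    (F' := fun x y => innerSL ℝ (Real.cos θ • G (Real.cos θ • x + Real.sin θ • y)))
    (bound := fun _ => L) Filter.univ_mem
    (.of_forall fun x => Continuous.aestronglyMeasurable (by fun_prop))
    (integrable_stdGaussian_of_bound (by fun_prop) fun y => hC _)
    (Continuous.aestronglyMeasurable (by fun_prop))
    (.of_forall fun y x _ => ?_) (integrable_const _) (.of_forall fun y x _ => ?_)
  · refine key.congr_fderiv ?_
    rw [(innerSL ℝ).integral_comp_comm, integral_smul]
    · rfl
    · exact integrable_stdGaussian_of_bound (C := |Real.cos θ| * L) (by fun_prop) fun y => by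
        rw [norm_smul]
        exact mul_le_mul_of_nonneg_left (hL _) (norm_nonneg _)
  · rw [innerSL_apply_norm, norm_smul]
    exact (mul_le_of_le_one_left (norm_nonneg _) (Real.abs_cos_le_one θ)).trans (hL _)
  · have h1 : HasFDerivAt (fun x : E => Real.cos θ • x + Real.sin θ • y)
        (Real.cos θ • ContinuousLinearMap.id ℝ E) x :=
      ((hasFDerivAt_id x).const_smul _).add_const _
    refine ((hG _).comp x h1).congr_fderiv ?_
    ext z
    simp

/-- The angular derivative of `mehler θ h x`. -/
def mehlerDeriv (G : E → E) (θ : ℝ) (x : E) : ℝ :=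
  ∫ y, inner ℝ (G (Real.cos θ • x + Real.sin θ • y)) (-Real.sin θ • x + Real.cos θ • y)
    ∂ProbabilityTheory.stdGaussian E

lemma hasDerivAt_mehler (θ : ℝ) (hG : ∀ x, HasFDerivAt h (innerSL ℝ (G x)) x)
    (hGc : Continuous G) (hC : ∀ x, ‖h x‖ ≤ C) (hL : ∀ x, ‖G x‖ ≤ L) (x : E) :
    HasDerivAt (fun θ => mehler θ h x) (mehlerDeriv G θ x) θ := by
  have hc : Continuous h := continuous_iff_continuousAt.2 fun x => (hG x).continuousAt
  refine (hasDerivAt_integral_of_dominated_loc_of_deriv_le (𝕜 := ℝ)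
    (μ := ProbabilityTheory.stdGaussian E) (x₀ := θ) (s := Set.univ)
    (F := fun θ y => h (Real.cos θ • x + Real.sin θ • y))
    (F' := fun θ y =>
      inner ℝ (G (Real.cos θ • x + Real.sin θ • y)) (-Real.sin θ • x + Real.cos θ • y))
    (bound := fun y => L * (‖x‖ + ‖y‖)) Filter.univ_mem
    (.of_forall fun x => Continuous.aestronglyMeasurable (by fun_prop))
    (integrable_stdGaussian_of_bound (by fun_prop) fun y => hC _)
    (Continuous.aestronglyMeasurable (by fun_prop))
    (.of_forall fun y θ _ => abs_inner_rotation_le hL θ x y)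
    (((integrable_const _).add integrable_norm_stdGaussian).const_mul _)
    (.of_forall fun y θ _ => ?_)).2
  have h1 : HasDerivAt (fun θ : ℝ => Real.cos θ • x + Real.sin θ • y)
      (-Real.sin θ • x + Real.cos θ • y) θ :=
    ((Real.hasDerivAt_cos θ).smul_const x).add ((Real.hasDerivAt_sin θ).smul_const y)
  exact (hG _).comp_hasDerivAt θ h1

lemma abs_mehlerDeriv_le (hL : ∀ x, ‖G x‖ ≤ L) (θ : ℝ) (x : E) :
    |mehlerDeriv G θ x| ≤ L * (‖x‖ + ∫ y, ‖y‖ ∂ProbabilityTheory.stdGaussian E) := by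
  rw [mehlerDeriv, ← Real.norm_eq_abs]
  refine (norm_integral_le_of_norm_le (g := fun y => L * (‖x‖ + ‖y‖))
    (((integrable_const ‖x‖).add integrable_norm_stdGaussian).const_mul L)
    (.of_forall fun y => abs_inner_rotation_le hL θ x y)).trans (le_of_eq ?_)
  rw [integral_const_mul]
  congr 1
  rw [integral_add (integrable_const _) integrable_norm_stdGaussian]
  simp

lemma aestronglyMeasurable_mehlerDeriv (hGc : Continuous G) (θ : ℝ) :
    AEStronglyMeasurable (mehlerDeriv G θ) (ProbabilityTheory.stdGaussian E) :=
  (Continuous.stronglyMeasurable (f := fun z : E × E =>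
    (inner ℝ (G (Real.cos θ • z.1 + Real.sin θ • z.2))
      (-Real.sin θ • z.1 + Real.cos θ • z.2) : ℝ))
    (by fun_prop)).integral_prod_right'.aestronglyMeasurable

variable {m : ℝ}

lemma hasDerivAt_integral_mul_log_mehler (hm0 : 0 < m) (hm : ∀ x, m ≤ h x)
    (hG : ∀ x, HasFDerivAt h (innerSL ℝ (G x)) x)
    (hGc : Continuous G) (hC : ∀ x, ‖h x‖ ≤ C) (hL : ∀ x, ‖G x‖ ≤ L) (θ : ℝ) :
    HasDerivAt (fun θ => ∫ x, mehler θ h x * Real.log (mehler θ h x)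
        ∂ProbabilityTheory.stdGaussian E)
      (∫ x, (Real.log (mehler θ h x) + 1) * mehlerDeriv G θ x ∂ProbabilityTheory.stdGaussian E)
      θ := by
  have hc : Continuous h := continuous_iff_continuousAt.2 fun x => (hG x).continuousAt
  have hQc : ∀ θ, Continuous (mehler θ h) := fun θ => continuous_mehler θ hc hC
  have hQ0 : ∀ θ x, m ≤ mehler θ h x := fun θ => le_mehler θ hc hm hC
  have hQ1 : ∀ θ x, mehler θ h x ≤ C := fun θ x => (le_abs_self _).trans (norm_mehler_le θ hC x)
  have hne : ∀ θ x, mehler θ h x ≠ 0 := fun θ x => (hm0.trans_le (hQ0 θ x)).ne'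
  have hlogc : ∀ θ, Continuous fun x => Real.log (mehler θ h x) :=
    fun θ => (hQc θ).log (hne θ)
  have hlog : ∀ θ x, |Real.log (mehler θ h x)| ≤ |Real.log m| + |Real.log C| :=
    fun θ x => abs_log_le hm0 (hQ0 θ x) (hQ1 θ x)
  refine (hasDerivAt_integral_of_dominated_loc_of_deriv_le (𝕜 := ℝ)
    (μ := ProbabilityTheory.stdGaussian E) (x₀ := θ) (s := Set.univ)
    (F := fun θ x => mehler θ h x * Real.log (mehler θ h x))
    (F' := fun θ x => (Real.log (mehler θ h x) + 1) * mehlerDeriv G θ x)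
    (bound := fun x => (|Real.log m| + |Real.log C| + 1) *
      (L * (‖x‖ + ∫ y, ‖y‖ ∂ProbabilityTheory.stdGaussian E))) Filter.univ_mem
    (.of_forall fun θ => ((hQc θ).mul (hlogc θ)).aestronglyMeasurable)
    (integrable_stdGaussian_of_bound ((hQc θ).mul (hlogc θ))
      (C := C * (|Real.log m| + |Real.log C|)) fun x => ?_)
    (((hlogc θ).add continuous_const).aestronglyMeasurable.mul
      (aestronglyMeasurable_mehlerDeriv hGc θ))
    (.of_forall fun x θ _ => ?_)
    (((integrable_norm_stdGaussian.add (integrable_const _)).const_mul _).const_mul _)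
    (.of_forall fun x θ _ => ?_)).2
  · rw [norm_mul]
    exact mul_le_mul (norm_mehler_le θ hC x) (hlog θ x) (norm_nonneg _)
      ((norm_nonneg _).trans (hC 0))
  · rw [norm_mul]
    refine mul_le_mul ?_ (abs_mehlerDeriv_le hL θ x) (norm_nonneg _) (by positivity)
    refine (norm_add_le _ _).trans ?_
    rw [norm_one]
    gcongr
    exact hlog θ x
  · exact (Real.hasDerivAt_mul_log (hne θ x)).comp θ (hasDerivAt_mehler θ hG hGc hC hL x)

/-- The angular derivative of the entropy along the semigroup, after integration by parts. -/
lemma integral_log_mul_mehlerDeriv (hm0 : 0 < m) (hm : ∀ x, m ≤ h x)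
    (hG : ∀ x, HasFDerivAt h (innerSL ℝ (G x)) x)
    (hGc : Continuous G) (hC : ∀ x, ‖h x‖ ≤ C) (hL : ∀ x, ‖G x‖ ≤ L) (θ : ℝ) :
    ∫ x, (Real.log (mehler θ h x) + 1) * mehlerDeriv G θ x ∂ProbabilityTheory.stdGaussian E
      = -(Real.sin θ * Real.cos θ) * ∫ z : E × E,
          inner ℝ ((mehler θ h z.1)⁻¹ • mehler θ G z.1) (G (Real.cos θ • z.1 + Real.sin θ • z.2))
          ∂(ProbabilityTheory.stdGaussian E).prod (ProbabilityTheory.stdGaussian E) := by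
  have hc : Continuous h := continuous_iff_continuousAt.2 fun x => (hG x).continuousAt
  have hQc : Continuous (mehler θ h) := continuous_mehler θ hc hC
  have hPc : Continuous (mehler θ G) := continuous_mehler θ hGc hL
  have hQ0 : ∀ x, m ≤ mehler θ h x := le_mehler θ hc hm hC
  have hQ1 : ∀ x, mehler θ h x ≤ C := fun x => (le_abs_self _).trans (norm_mehler_le θ hC x)
  have hne : ∀ x, mehler θ h x ≠ 0 := fun x => (hm0.trans_le (hQ0 x)).ne'
  have hL0 : 0 ≤ L := (norm_nonneg _).trans (hL 0)
  set ψ : E → ℝ := fun x => Real.log (mehler θ h x) + 1 with hψ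
  set a : E → E := fun x => (mehler θ h x)⁻¹ • mehler θ G x with ha
  have hψc : Continuous ψ := (hQc.log hne).add continuous_const
  have hac : Continuous a := (hQc.inv₀ hne).smul hPc
  have hψb : ∀ x, |ψ x| ≤ |Real.log m| + |Real.log C| + 1 := fun x =>
    (abs_add_le _ _).trans (by rw [abs_one]; gcongr; exact abs_log_le hm0 (hQ0 x) (hQ1 x))
  have hab : ∀ x, ‖a x‖ ≤ m⁻¹ * L := fun x => by
    rw [ha, norm_smul, norm_inv, Real.norm_of_nonneg (hm0.le.trans (hQ0 x))]
    exact mul_le_mul (inv_anti₀ hm0 (hQ0 x)) (norm_mehler_le θ hL x) (norm_nonneg _)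
      (inv_nonneg.2 hm0.le)
  have hψd : ∀ x, HasFDerivAt ψ (innerSL ℝ (Real.cos θ • a x)) x := fun x => by
    refine (((hasFDerivAt_mehler θ hG hGc hC hL x).log (hne x)).add_const 1).congr_fderiv ?_
    ext y
    simp [ha]
    ring
  set γ := ProbabilityTheory.stdGaussian E
  have hint1 : Integrable (fun z : E × E => ψ z.1 *
      inner ℝ (G (Real.cos θ • z.1 + Real.sin θ • z.2)) (-Real.sin θ • z.1 + Real.cos θ • z.2))
      (γ.prod γ) := by
    refine Integrable.mono' (g := fun z => (|Real.log m| + |Real.log C| + 1) *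
      (L * (‖z.1‖ + ‖z.2‖))) (((Integrable.comp_fst integrable_norm_stdGaussian γ).add
        (Integrable.comp_snd integrable_norm_stdGaussian γ)).const_mul L |>.const_mul _)
      (Continuous.aestronglyMeasurable (by fun_prop)) (.of_forall fun z => ?_)
    rw [norm_mul]
    exact mul_le_mul (hψb _) (abs_inner_rotation_le hL θ z.1 z.2) (norm_nonneg _) (by positivity)
  have hint2 : Integrable (fun z : E × E =>
      ψ (Real.cos θ • z.1 - Real.sin θ • z.2) * inner ℝ (G z.1) z.2) (γ.prod γ) := by
    refine Integrable.mono' (g := fun z => (|Real.log m| + |Real.log C| + 1) *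
      (L * ‖z.2‖)) ((Integrable.comp_snd integrable_norm_stdGaussian γ).const_mul L |>.const_mul _)
      (Continuous.aestronglyMeasurable (by fun_prop)) (.of_forall fun z => ?_)
    rw [norm_mul]
    refine mul_le_mul (hψb _) ?_ (norm_nonneg _) (by positivity)
    exact (norm_inner_le_norm _ _).trans (by gcongr; exact hL _)
  have hint3 : Integrable (fun z : E × E =>
      (inner ℝ (a (Real.cos θ • z.1 - Real.sin θ • z.2)) (G z.1) : ℝ)) (γ.prod γ) := by
    refine Integrable.of_bound (Continuous.aestronglyMeasurable (by fun_prop)) (m⁻¹ * L * L)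
      (.of_forall fun z => ?_)
    exact (norm_inner_le_norm _ _).trans (mul_le_mul (hab _) (hL _) (norm_nonneg _) (by positivity))
  have hrot : ∀ z : E × E, Real.cos θ • (Real.cos θ • z.1 + Real.sin θ • z.2)
      - Real.sin θ • (-Real.sin θ • z.1 + Real.cos θ • z.2) = z.1 := fun z => by
    have : z.1 = (Real.cos θ ^ 2 + Real.sin θ ^ 2) • z.1 := by simp
    conv_rhs => rw [this]
    module
  calc ∫ x, ψ x * mehlerDeriv G θ x ∂γ
      = ∫ z : E × E, ψ z.1 * inner ℝ (G (Real.cos θ • z.1 + Real.sin θ • z.2))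
          (-Real.sin θ • z.1 + Real.cos θ • z.2) ∂γ.prod γ := by
        rw [integral_prod _ hint1]
        simp_rw [integral_const_mul]
        rfl
    _ = ∫ z : E × E, ψ (Real.cos θ • z.1 - Real.sin θ • z.2) * inner ℝ (G z.1) z.2
          ∂γ.prod γ := by
        rw [← integral_rotation_stdGaussian (f := fun z : E × E =>
          ψ (Real.cos θ • z.1 - Real.sin θ • z.2) * inner ℝ (G z.1) z.2) (by fun_prop) θ]
        simp only [ContinuousLinearMap.rotation_apply, hrot]
        rfl
    _ = ∫ u, ∫ v, ψ (Real.cos θ • u - Real.sin θ • v) * inner ℝ (G u) v ∂γ ∂γ :=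
        integral_prod _ hint2
    _ = ∫ u, ∫ v, -(Real.sin θ * Real.cos θ) *
          inner ℝ (a (Real.cos θ • u - Real.sin θ • v)) (G u) ∂γ ∂γ := by
        congr 1 with u
        rw [integral_mul_inner_stdGaussian (F := fun v => ψ (Real.cos θ • u - Real.sin θ • v))
          (F' := fun v => -(Real.sin θ * Real.cos θ) • a (Real.cos θ • u - Real.sin θ • v))
          (A := |Real.log m| + |Real.log C| + 1) (B := |Real.sin θ * Real.cos θ| * (m⁻¹ * L))
          (G u) (fun v => ?_) (by fun_prop) (fun v => hψb _) (fun v => ?_)]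
        · simp_rw [inner_smul_left]
          rfl
        · have h1 : HasFDerivAt (fun v : E => Real.cos θ • u - Real.sin θ • v)
              (-(Real.sin θ • ContinuousLinearMap.id ℝ E)) v :=
            ((hasFDerivAt_id v).const_smul _).const_sub _
          refine ((hψd _).comp v h1).congr_fderiv ?_
          ext z
          simp
          ring
        · rw [norm_smul, norm_neg]
          exact mul_le_mul_of_nonneg_left (hab _) (norm_nonneg _)
    _ = -(Real.sin θ * Real.cos θ) * ∫ z : E × E,
          inner ℝ (a (Real.cos θ • z.1 - Real.sin θ • z.2)) (G z.1) ∂γ.prod γ := by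
        rw [← integral_const_mul, integral_prod _ (hint3.const_mul _)]
    _ = _ := by
        congr 1
        rw [← integral_rotation_stdGaussian (f := fun z : E × E =>
          (inner ℝ (a (Real.cos θ • z.1 - Real.sin θ • z.2)) (G z.1) : ℝ)) (by fun_prop) θ]
        simp only [ContinuousLinearMap.rotation_apply, hrot]
        rfl

lemma integral_inner_mehler_le (hm0 : 0 < m) (hm : ∀ x, m ≤ h x) (hc : Continuous h)
    (hGc : Continuous G) (hC : ∀ x, ‖h x‖ ≤ C) (hL : ∀ x, ‖G x‖ ≤ L) (θ : ℝ) :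
    ∫ z : E × E,
        inner ℝ ((mehler θ h z.1)⁻¹ • mehler θ G z.1) (G (Real.cos θ • z.1 + Real.sin θ • z.2))
        ∂(ProbabilityTheory.stdGaussian E).prod (ProbabilityTheory.stdGaussian E)
      ≤ ∫ x, ‖G x‖ ^ 2 / h x ∂ProbabilityTheory.stdGaussian E := by
  have hQc : Continuous (mehler θ h) := continuous_mehler θ hc hC
  have hPc : Continuous (mehler θ G) := continuous_mehler θ hGc hL
  have hQ0 : ∀ x, m ≤ mehler θ h x := le_mehler θ hc hm hC
  have hne : ∀ x, mehler θ h x ≠ 0 := fun x => (hm0.trans_le (hQ0 x)).ne'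
  have hpos : ∀ x, 0 < h x := fun x => hm0.trans_le (hm x)
  have hL0 : 0 ≤ L := (norm_nonneg _).trans (hL 0)
  have hC0 : 0 ≤ C := (norm_nonneg _).trans (hC 0)
  set a : E → E := fun x => (mehler θ h x)⁻¹ • mehler θ G x with ha
  have hac : Continuous a := (hQc.inv₀ hne).smul hPc
  have hab : ∀ x, ‖a x‖ ≤ m⁻¹ * L := fun x => by
    rw [ha, norm_smul, norm_inv, Real.norm_of_nonneg (hm0.le.trans (hQ0 x))]
    exact mul_le_mul (inv_anti₀ hm0 (hQ0 x)) (norm_mehler_le θ hL x) (norm_nonneg _)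
      (inv_nonneg.2 hm0.le)
  set γ := ProbabilityTheory.stdGaussian E
  have hNc : Continuous fun x => ‖G x‖ ^ 2 / h x := by
    have := fun x => (hpos x).ne'
    fun_prop (disch := assumption)
  have i1 : Integrable (fun z : E × E =>
      (inner ℝ (a z.1) (G (Real.cos θ • z.1 + Real.sin θ • z.2)) : ℝ)) (γ.prod γ) := by
    refine Integrable.of_bound (Continuous.aestronglyMeasurable (by fun_prop)) (m⁻¹ * L * L)
      (.of_forall fun z => ?_)
    exact (norm_inner_le_norm _ _).trans (mul_le_mul (hab _) (hL _) (norm_nonneg _) (by positivity))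
  have i2 : Integrable (fun z : E × E =>
      ‖a z.1‖ ^ 2 * h (Real.cos θ • z.1 + Real.sin θ • z.2)) (γ.prod γ) := by
    refine Integrable.of_bound (Continuous.aestronglyMeasurable (by fun_prop)) ((m⁻¹ * L) ^ 2 * C)
      (.of_forall fun z => ?_)
    rw [norm_mul, norm_pow, norm_norm]
    exact mul_le_mul (pow_le_pow_left₀ (norm_nonneg _) (hab _) 2) (hC _) (norm_nonneg _)
      (by positivity)
  have i3 : Integrable (fun z : E × E =>
      ‖G (Real.cos θ • z.1 + Real.sin θ • z.2)‖ ^ 2 / h (Real.cos θ • z.1 + Real.sin θ • z.2))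
      (γ.prod γ) := by
    refine Integrable.of_bound (Continuous.aestronglyMeasurable
      (hNc.comp (by fun_prop : Continuous fun z : E × E => Real.cos θ • z.1 + Real.sin θ • z.2)))
      (L ^ 2 / m) (.of_forall fun z => ?_)
    rw [Real.norm_of_nonneg (div_nonneg (sq_nonneg _) (hpos _).le)]
    exact div_le_div₀ (by positivity) (pow_le_pow_left₀ (norm_nonneg _) (hL _) 2) hm0 (hm _)
  have e1 : ∫ z : E × E, inner ℝ (a z.1) (G (Real.cos θ • z.1 + Real.sin θ • z.2)) ∂γ.prod γ
      = ∫ z : E × E, ‖a z.1‖ ^ 2 * h (Real.cos θ • z.1 + Real.sin θ • z.2) ∂γ.prod γ := by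
    rw [integral_prod _ i1, integral_prod _ i2]
    congr 1 with x
    simp only
    rw [integral_const_mul]
    change ∫ y, innerSL ℝ (a x) (G (Real.cos θ • x + Real.sin θ • y)) ∂γ
      = ‖a x‖ ^ 2 * mehler θ h x
    rw [ContinuousLinearMap.integral_comp_comm _
      (integrable_stdGaussian_of_bound (by fun_prop) fun y => hL _)]
    change inner ℝ (a x) (mehler θ G x) = _
    have : mehler θ G x = mehler θ h x • a x := by
      rw [ha, smul_smul, mul_inv_cancel₀ (hne x), one_smul]
    rw [this, inner_smul_right, real_inner_self_eq_norm_sq, mul_comm]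
  have e2 : ∫ z : E × E, ‖G (Real.cos θ • z.1 + Real.sin θ • z.2)‖ ^ 2
        / h (Real.cos θ • z.1 + Real.sin θ • z.2) ∂γ.prod γ = ∫ x, ‖G x‖ ^ 2 / h x ∂γ := by
    have := integral_rotation_stdGaussian (f := fun z : E × E => ‖G z.1‖ ^ 2 / h z.1)
      (hNc.comp continuous_fst) θ
    simp only [ContinuousLinearMap.rotation_apply] at this
    rw [this, integral_fun_fst (fun x => ‖G x‖ ^ 2 / h x)]
    simp [γ]
  have e3 : ∫ z : E × E, (2 * inner ℝ (a z.1) (G (Real.cos θ • z.1 + Real.sin θ • z.2))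
        - ‖a z.1‖ ^ 2 * h (Real.cos θ • z.1 + Real.sin θ • z.2)) ∂γ.prod γ
      ≤ ∫ z : E × E, ‖G (Real.cos θ • z.1 + Real.sin θ • z.2)‖ ^ 2
        / h (Real.cos θ • z.1 + Real.sin θ • z.2) ∂γ.prod γ := by
    refine integral_mono ((i1.const_mul 2).sub i2) i3 fun z => ?_
    simp only
    generalize Real.cos θ • z.1 + Real.sin θ • z.2 = u
    rw [le_div_iff₀ (hpos u)]
    have h1 := abs_le.1 (abs_real_inner_le_norm (a z.1) (G u))
    nlinarith [sq_nonneg (‖G u‖ - h u * ‖a z.1‖), mul_le_mul_of_nonneg_left h1.2 (hpos u).le]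
  rw [integral_sub (i1.const_mul 2) i2, integral_const_mul, ← e1, e2] at e3
  linarith

/-- The logarithmic Sobolev inequality for regular densities bounded away from zero. -/
lemma integral_mul_log_le_of_regular (hm0 : 0 < m) (hm : ∀ x, m ≤ h x)
    (hG : ∀ x, HasFDerivAt h (innerSL ℝ (G x)) x)
    (hGc : Continuous G) (hC : ∀ x, ‖h x‖ ≤ C) (hL : ∀ x, ‖G x‖ ≤ L) :
    ∫ x, h x * Real.log (h x) ∂ProbabilityTheory.stdGaussian E
      ≤ 1 / 2 * (∫ x, ‖G x‖ ^ 2 / h x ∂ProbabilityTheory.stdGaussian E)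
        + (∫ x, h x ∂ProbabilityTheory.stdGaussian E)
          * Real.log (∫ x, h x ∂ProbabilityTheory.stdGaussian E) := by
  have hc : Continuous h := continuous_iff_continuousAt.2 fun x => (hG x).continuousAt
  set K := ∫ x, ‖G x‖ ^ 2 / h x ∂ProbabilityTheory.stdGaussian E with hK
  set T : ℝ → ℝ := fun θ => ∫ x, mehler θ h x * Real.log (mehler θ h x)
    ∂ProbabilityTheory.stdGaussian E with hT
  have hd : ∀ θ, HasDerivAt (fun θ => T θ + 1 / 2 * K * Real.sin θ ^ 2)
      ((∫ x, (Real.log (mehler θ h x) + 1) * mehlerDeriv G θ x ∂ProbabilityTheory.stdGaussian E)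
        + 1 / 2 * K * (2 * Real.sin θ * Real.cos θ)) θ := fun θ => by
    refine (hasDerivAt_integral_mul_log_mehler hm0 hm hG hGc hC hL θ).add ?_
    have := (((Real.hasDerivAt_sin θ).pow 2).const_mul (1 / 2 * K))
    simpa using this
  have hmono : MonotoneOn (fun θ => T θ + 1 / 2 * K * Real.sin θ ^ 2)
      (Set.Icc 0 (Real.pi / 2)) := by
    refine monotoneOn_of_hasDerivWithinAt_nonneg (convex_Icc _ _)
      (fun θ _ => (hd θ).continuousAt.continuousWithinAt)
      (fun θ _ => (hd θ).hasDerivWithinAt) fun θ hθ => ?_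
    rw [interior_Icc] at hθ
    have hs : 0 ≤ Real.sin θ := Real.sin_nonneg_of_nonneg_of_le_pi hθ.1.le
      (by linarith [hθ.2, Real.pi_pos])
    have hcos : 0 ≤ Real.cos θ := Real.cos_nonneg_of_mem_Icc
      ⟨by linarith [hθ.1, Real.pi_pos], hθ.2.le⟩
    rw [integral_log_mul_mehlerDeriv hm0 hm hG hGc hC hL θ]
    have := mul_le_mul_of_nonneg_left (integral_inner_mehler_le hm0 hm hc hGc hC hL θ)
      (mul_nonneg hs hcos)
    rw [← hK] at this
    linarith
  have h0 : (0 : ℝ) ≤ Real.pi / 2 := by positivity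
  have := hmono (Set.left_mem_Icc.2 h0) (Set.right_mem_Icc.2 h0) h0
  simpa [hT, mehler, add_comm] using this

end Mehler

section EntropyLimit

variable {α : Type*} [MeasurableSpace α] {μ : Measure α}

/-- Fatou's lemma for real-valued functions with convergent upper bounds on the integrals. -/
lemma integrable_and_integral_le_of_tendsto {u : ℕ → α → ℝ} {v : α → ℝ} {b : ℕ → ℝ} {B : ℝ}
    (hu0 : ∀ n x, 0 ≤ u n x) (hui : ∀ n, Integrable (u n) μ)
    (hv : ∀ᵐ x ∂μ, Filter.Tendsto (fun n => u n x) Filter.atTop (nhds (v x)))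
    (hb : ∀ n, ∫ x, u n x ∂μ ≤ b n) (hB : Filter.Tendsto b Filter.atTop (nhds B)) :
    Integrable v μ ∧ ∫ x, v x ∂μ ≤ B := by
  have hvm : AEStronglyMeasurable v μ :=
    aestronglyMeasurable_of_tendsto_ae _ (fun n => (hui n).aestronglyMeasurable) hv
  have hv0 : 0 ≤ᵐ[μ] v := hv.mono fun x hx => ge_of_tendsto' hx fun n => hu0 n x
  have hB0 : 0 ≤ B := ge_of_tendsto' hB fun n => (integral_nonneg (hu0 n)).trans (hb n)
  have key : ∫⁻ x, ENNReal.ofReal (v x) ∂μ ≤ ENNReal.ofReal B := by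
    calc ∫⁻ x, ENNReal.ofReal (v x) ∂μ
        = ∫⁻ x, Filter.liminf (fun n => ENNReal.ofReal (u n x)) Filter.atTop ∂μ :=
          lintegral_congr_ae (hv.mono fun x hx =>
            ((ENNReal.continuous_ofReal.tendsto _).comp hx).liminf_eq.symm)
      _ ≤ Filter.liminf (fun n => ∫⁻ x, ENNReal.ofReal (u n x) ∂μ) Filter.atTop :=
          lintegral_liminf_le' fun n => (hui n).aemeasurable.ennreal_ofReal
      _ ≤ Filter.liminf (fun n => ENNReal.ofReal (b n)) Filter.atTop := by
          refine Filter.liminf_le_liminf (.of_forall fun n => ?_)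
          rw [← ofReal_integral_eq_lintegral_ofReal (hui n) (.of_forall (hu0 n))]
          exact ENNReal.ofReal_le_ofReal (hb n)
      _ = ENNReal.ofReal B := ((ENNReal.continuous_ofReal.tendsto _).comp hB).liminf_eq
  refine ⟨⟨hvm, ?_⟩, ?_⟩
  · rw [hasFiniteIntegral_iff_ofReal hv0]
    exact key.trans_lt ENNReal.ofReal_lt_top
  · rw [integral_eq_lintegral_of_nonneg_ae hv0 hvm]
    exact ENNReal.toReal_le_of_le_ofReal hB0 key

lemma neg_one_le_mul_log {t : ℝ} (ht : 0 ≤ t) : -1 ≤ t * Real.log t := by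
  rcases ht.eq_or_lt with rfl | ht
  · simp
  · have h := Real.log_le_sub_one_of_pos (inv_pos.2 ht)
    rw [Real.log_inv] at h
    have h2 := mul_le_mul_of_nonneg_left h ht.le
    rw [mul_sub, mul_inv_cancel₀ ht.ne'] at h2
    linarith

/-- Entropy bounds pass to almost everywhere limits when the masses do not increase. -/
lemma integrable_mul_log_and_integral_le_of_tendsto [IsProbabilityMeasure μ]
    {u : ℕ → α → ℝ} {v : α → ℝ} {M K : ℕ → ℝ} {K' : ℝ}
    (hu0 : ∀ n x, 0 ≤ u n x) (hui : ∀ n, Integrable (u n) μ)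
    (hv : ∀ᵐ x ∂μ, Filter.Tendsto (fun n => u n x) Filter.atTop (nhds (v x)))
    (hM : ∀ n, ∫ x, u n x ∂μ ≤ M n)
    (hM' : Filter.Tendsto M Filter.atTop (nhds (∫ x, v x ∂μ)))
    (hul : ∀ n, Integrable (fun x => u n x * Real.log (u n x)) μ)
    (hK : ∀ n, ∫ x, u n x * Real.log (u n x) ∂μ
      ≤ K n + (∫ x, u n x ∂μ) * Real.log (∫ x, u n x ∂μ))
    (hK' : Filter.Tendsto K Filter.atTop (nhds K')) :
    Integrable (fun x => v x * Real.log (v x)) μ ∧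
      ∫ x, v x * Real.log (v x) ∂μ ≤ K' + (∫ x, v x ∂μ) * Real.log (∫ x, v x ∂μ) := by
  have hlim : Filter.Tendsto (fun n => ∫ x, u n x ∂μ) Filter.atTop (nhds (∫ x, v x ∂μ)) := by
    refine Filter.tendsto_of_subseq_tendsto fun ns hns => ?_
    obtain ⟨R, hR⟩ := (hM'.bddAbove_range)
    have hbd : ∀ n, (∫ x, u (ns n) x ∂μ) ∈ Set.Icc 0 R := fun n =>
      ⟨integral_nonneg (hu0 _), (hM _).trans (hR ⟨ns n, rfl⟩)⟩
    obtain ⟨a, -, ms, hms, ha⟩ := isCompact_Icc.tendsto_subseq hbd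
    refine ⟨ms, ?_⟩
    have hsub := hns.comp hms.tendsto_atTop
    have h1 : ∫ x, v x ∂μ ≤ a := (integrable_and_integral_le_of_tendsto
      (u := fun n => u (ns (ms n))) (fun n => hu0 _) (fun n => hui _)
      (hv.mono fun x hx => hx.comp hsub) (fun n => le_rfl) ha).2
    have h2 : a ≤ ∫ x, v x ∂μ := le_of_tendsto_of_tendsto' ha (hM'.comp hsub) fun n => hM _
    rw [h1.antisymm h2]
    exact ha
  have hadd : ∀ n, ∫ x, (u n x * Real.log (u n x) + 1) ∂μ
      = (∫ x, u n x * Real.log (u n x) ∂μ) + 1 := fun n => by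
    rw [integral_add (hul n) (integrable_const _)]; simp
  obtain ⟨h1, h2⟩ := integrable_and_integral_le_of_tendsto
    (u := fun n x => u n x * Real.log (u n x) + 1) (v := fun x => v x * Real.log (v x) + 1)
    (b := fun n => K n + (∫ x, u n x ∂μ) * Real.log (∫ x, u n x ∂μ) + 1)
    (fun n x => by linarith [neg_one_le_mul_log (hu0 n x)])
    (fun n => (hul n).add (integrable_const _))
    (hv.mono fun x hx => ((Real.continuous_mul_log.tendsto _).comp hx).add_const 1)
    (fun n => by rw [hadd]; linarith [hK n])
    ((hK'.add ((Real.continuous_mul_log.tendsto _).comp hlim)).add_const 1)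
  have h3 : Integrable (fun x => v x * Real.log (v x)) μ :=
    (h1.sub (integrable_const 1)).congr (.of_forall fun x => by simp)
  refine ⟨h3, ?_⟩
  rw [integral_add h3 (integrable_const _)] at h2
  simp only [integral_const, probReal_univ, smul_eq_mul, mul_one] at h2
  linarith

end EntropyLimit

section Mollification

open scoped Convolution

open ContinuousLinearMap (lsmul)

variable {E : Type*} [NormedAddCommGroup E] [InnerProductSpace ℝ E] [FiniteDimensional ℝ E]
  [MeasurableSpace E] [BorelSpace E]

/-- `G` is the weak gradient of `F`, tested in every fixed direction. -/
def HasWeakGradient (F : E → ℝ) (G : E → E) : Prop :=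
  ∀ φ : E → ℝ, ContDiff ℝ (⊤ : ℕ∞) φ → HasCompactSupport φ → ∀ z : E,
    ∫ x, F x * fderiv ℝ φ x z = -∫ x, φ x * inner ℝ (G x) z

variable {ρ : E → ℝ} {F : E → ℝ} {G : E → E}

lemma HasWeakGradient.hasFDerivAt_convolution (h : HasWeakGradient F G)
    (hF : LocallyIntegrable F) (hG : LocallyIntegrable G) (hρ : ContDiff ℝ (⊤ : ℕ∞) ρ)
    (hρc : HasCompactSupport ρ) (x : E) :
    HasFDerivAt (ρ ⋆[lsmul ℝ ℝ] F) (innerSL ℝ ((ρ ⋆[lsmul ℝ ℝ] G) x)) x := by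
  have hρ1 : ContDiff ℝ 1 ρ := hρ.of_le (by exact_mod_cast le_top)
  refine (hρc.hasFDerivAt_convolution_left (lsmul ℝ ℝ) hρ1 hF x).congr_fderiv ?_
  ext z
  have i1 := ((hρc.fderiv (𝕜 := ℝ)).convolutionExists_left ((lsmul ℝ ℝ).precompL E)
    (hρ1.continuous_fderiv one_ne_zero) hF x).integrable_swap
  have i2 := (hρc.convolutionExists_left (lsmul ℝ ℝ) hρ1.continuous hG x).integrable_swap
  have hd : ∀ y, fderiv ℝ (fun y => ρ (x - y)) y z = -(fderiv ℝ ρ (x - y) z) := fun y => by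
    have h1 : HasFDerivAt (fun y => x - y) (-(ContinuousLinearMap.id ℝ E)) y :=
      (hasFDerivAt_id y).const_sub x
    have h2 := ((hρ1.differentiable one_ne_zero (x - y)).hasFDerivAt).comp y h1
    rw [show (fun y => ρ (x - y)) = ρ ∘ fun y => x - y from rfl, h2.fderiv]
    simp
  have key := h (fun y => ρ (x - y)) (hρ.comp (contDiff_const.sub contDiff_id))
    (hρc.comp_homeomorph (Homeomorph.subLeft x)) z
  simp_rw [hd, mul_neg] at key
  rw [integral_neg, neg_inj] at key
  rw [convolution_eq_swap, convolution_eq_swap, ContinuousLinearMap.integral_apply i1,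
    innerSL_apply_apply, real_inner_comm, ← integral_inner i2]
  refine (integral_congr_ae (.of_forall fun y => ?_)).trans
    (key.trans (integral_congr_ae (.of_forall fun y => ?_)))
  · simp [mul_comm]
  · simp [inner_smul_right, real_inner_comm]

variable {V : Type*} [NormedAddCommGroup V] [InnerProductSpace ℝ V] {H : E → V}

lemma exists_norm_convolution_le (hρ : Continuous ρ) (hρc : HasCompactSupport ρ)
    (hH : Integrable H) : ∃ C, ∀ x, ‖(ρ ⋆[lsmul ℝ ℝ] H) x‖ ≤ C := by
  obtain ⟨C, hC⟩ := hρc.exists_bound_of_continuous hρ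
  refine ⟨∫ y, C * ‖H y‖, fun x => ?_⟩
  rw [convolution_eq_swap]
  refine norm_integral_le_of_norm_le (hH.norm.const_mul C) (.of_forall fun y => ?_)
  rw [ContinuousLinearMap.lsmul_apply, norm_smul]
  exact mul_le_mul_of_nonneg_right (hC _) (norm_nonneg _)

/-- Jensen's inequality for the square of the norm of a mollification. -/
lemma sq_norm_convolution_le [CompleteSpace V] (hρ : Continuous ρ) (hρc : HasCompactSupport ρ)
    (hρ0 : ∀ x, 0 ≤ ρ x) (hρ1 : ∫ x, ρ x = 1) (hH : LocallyIntegrable H)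
    (hH2 : LocallyIntegrable fun x => ‖H x‖ ^ 2) (x : E) :
    ‖(ρ ⋆[lsmul ℝ ℝ] H) x‖ ^ 2 ≤ (ρ ⋆[lsmul ℝ ℝ] fun x => ‖H x‖ ^ 2) x := by
  have i1 := hρc.convolutionExists_left (lsmul ℝ ℝ) hρ hH x
  have i2 := hρc.convolutionExists_left (lsmul ℝ ℝ) hρ hH2 x
  have hc : (ρ ⋆[lsmul ℝ ℝ] H) x = ∫ t, ρ t • H (x - t) := rfl
  rw [show (ρ ⋆[lsmul ℝ ℝ] fun x => ‖H x‖ ^ 2) x = ∫ t, ρ t * ‖H (x - t)‖ ^ 2 from rfl]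
  set c := (ρ ⋆[lsmul ℝ ℝ] H) x
  have i1' : Integrable fun t => ρ t • H (x - t) := i1
  have i2' : Integrable fun t => ρ t * ‖H (x - t)‖ ^ 2 := i2
  have i3 : Integrable ρ := hρ.integrable_of_hasCompactSupport hρc
  have i4 : Integrable fun t => (inner ℝ c (ρ t • H (x - t)) : ℝ) := i1'.const_inner c
  have h1 : ∫ t, (2 * inner ℝ c (ρ t • H (x - t)) - ‖c‖ ^ 2 * ρ t)
      ≤ ∫ t, ρ t * ‖H (x - t)‖ ^ 2 := by
    refine integral_mono ((i4.const_mul 2).sub (i3.const_mul _)) i2' fun t => ?_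
    simp only [inner_smul_right]
    have h2 := abs_le.1 (abs_real_inner_le_norm c (H (x - t)))
    have h3 : 0 ≤ ρ t * (‖c‖ - ‖H (x - t)‖) ^ 2 := mul_nonneg (hρ0 t) (sq_nonneg _)
    nlinarith [mul_le_mul_of_nonneg_left h2.2 (hρ0 t)]
  rw [integral_sub (i4.const_mul 2) (i3.const_mul _), integral_const_mul, integral_const_mul,
    integral_inner i1', ← hc, hρ1, real_inner_self_eq_norm_sq] at h1
  linarith

lemma integral_convolution_stdGaussian {w : E → ℝ} (hρ : Continuous ρ)
    (hρc : HasCompactSupport ρ) (hw : Integrable w) :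
    ∫ x, (ρ ⋆[lsmul ℝ ℝ] w) x ∂ProbabilityTheory.stdGaussian E
      = (ρ ⋆[lsmul ℝ ℝ] (w ⋆[lsmul ℝ ℝ] gaussianDensity)) 0 := by
  have hb := bddAbove_range_norm_gaussianDensity (E := E)
  have hb' : BddAbove (Set.range fun x : E => ‖‖gaussianDensity x‖‖) := by simpa using hb
  rw [← convolution_assoc (lsmul ℝ ℝ) (lsmul ℝ ℝ) (lsmul ℝ ℝ) (lsmul ℝ ℝ)
    (fun x y z => by simp [mul_assoc]) hρ.aestronglyMeasurable hw.aestronglyMeasurable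
    continuous_gaussianDensity.aestronglyMeasurable
    (.of_forall (hρc.convolutionExists_left _ hρ hw.locallyIntegrable))
    (.of_forall fun x => ?_) ?_]
  · rw [integral_stdGaussian, convolution_def]
    refine integral_congr_ae (.of_forall fun x => ?_)
    simp [gaussianDensity_neg, mul_comm]
  · refine HasCompactSupport.convolutionExists_left _ hρc.norm hρ.norm ?_ 0
    exact (hb'.continuous_convolution_right_of_integrable _ hw.norm
      continuous_gaussianDensity.norm).locallyIntegrable
  · exact BddAbove.convolutionExistsAt _ (s := Set.univ)
      (hb'.mono (Set.image_subset_range _ _)) MeasurableSet.univ (Set.subset_univ _)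
      hw.norm.integrableOn continuous_gaussianDensity.norm.aestronglyMeasurable

lemma tendsto_integral_convolution_stdGaussian {w : E → ℝ} (hw : Integrable w)
    {b : ℕ → ContDiffBump (0 : E)}
    (hb : Filter.Tendsto (fun n => (b n).rOut) Filter.atTop (nhds 0)) :
    Filter.Tendsto (fun n => ∫ x, ((b n).normed volume ⋆[lsmul ℝ ℝ] w) x
        ∂ProbabilityTheory.stdGaussian E) Filter.atTop
      (nhds (∫ x, w x ∂ProbabilityTheory.stdGaussian E)) := by
  have h0 : (w ⋆[lsmul ℝ ℝ] gaussianDensity) 0 = ∫ x, w x ∂ProbabilityTheory.stdGaussian E := by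
    rw [integral_stdGaussian, convolution_def]
    refine integral_congr_ae (.of_forall fun x => ?_)
    simp [gaussianDensity_neg, mul_comm]
  rw [← h0]
  refine Filter.Tendsto.congr (fun n => (integral_convolution_stdGaussian
    (b n).continuous_normed (b n).hasCompactSupport_normed hw).symm) ?_
  exact ContDiffBump.convolution_tendsto_right_of_continuous hb
    (bddAbove_range_norm_gaussianDensity.continuous_convolution_right_of_integrable _ hw
      continuous_gaussianDensity) 0

end Mollification

section LogSobolevOfIntegrable

open scoped Convolution

open ContinuousLinearMap (lsmul)

variable {E : Type*} [NormedAddCommGroup E] [InnerProductSpace ℝ E] [FiniteDimensional ℝ E]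
  [MeasurableSpace E] [BorelSpace E] {F : E → ℝ} {G : E → E}

lemma integrable_convolution_stdGaussian {ρ w : E → ℝ} (hρ : Continuous ρ)
    (hρc : HasCompactSupport ρ) (hw : Integrable w) :
    Integrable (ρ ⋆[lsmul ℝ ℝ] w) (ProbabilityTheory.stdGaussian E) := by
  obtain ⟨C, hC⟩ := exists_norm_convolution_le hρ hρc hw
  exact integrable_stdGaussian_of_bound
    (hρc.continuous_convolution_left _ hρ hw.locallyIntegrable) hC

lemma integral_mul_log_convolution_le (h : HasWeakGradient F G)
    (hF : Integrable F) (hG : Integrable G) (hF2 : Integrable fun x => F x ^ 2)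
    (hG2 : Integrable fun x => ‖G x‖ ^ 2) (b : ContDiffBump (0 : E)) {ε : ℝ} (hε : 0 < ε) :
    let u := fun x => (b.normed volume ⋆[lsmul ℝ ℝ] F) x ^ 2 + ε
    Integrable u (ProbabilityTheory.stdGaussian E) ∧
    Integrable (fun x => u x * Real.log (u x)) (ProbabilityTheory.stdGaussian E) ∧
    ∫ x, u x ∂ProbabilityTheory.stdGaussian E ≤
      (∫ x, (b.normed volume ⋆[lsmul ℝ ℝ] fun x => F x ^ 2) x
        ∂ProbabilityTheory.stdGaussian E) + ε ∧
    ∫ x, u x * Real.log (u x) ∂ProbabilityTheory.stdGaussian E ≤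
      2 * (∫ x, (b.normed volume ⋆[lsmul ℝ ℝ] fun x => ‖G x‖ ^ 2) x
        ∂ProbabilityTheory.stdGaussian E) +
      (∫ x, u x ∂ProbabilityTheory.stdGaussian E) *
        Real.log (∫ x, u x ∂ProbabilityTheory.stdGaussian E) := by
  intro u
  have hρ := b.continuous_normed (μ := volume)
  have hρc := b.hasCompactSupport_normed (μ := volume)
  have hρ0 := b.nonneg_normed (μ := volume)
  have hρ1 := b.integral_normed (μ := volume)
  have hderiv := h.hasFDerivAt_convolution hF.locallyIntegrable hG.locallyIntegrable
    b.contDiff_normed hρc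
  have hJF := sq_norm_convolution_le hρ hρc hρ0 hρ1 hF.locallyIntegrable
    (by simpa using hF2.locallyIntegrable)
  have hJG := sq_norm_convolution_le hρ hρc hρ0 hρ1 hG.locallyIntegrable hG2.locallyIntegrable
  have iF := integrable_convolution_stdGaussian hρ hρc hF2
  have iG := integrable_convolution_stdGaussian hρ hρc hG2
  obtain ⟨A, hA⟩ := exists_norm_convolution_le hρ hρc hF
  obtain ⟨B, hB⟩ := exists_norm_convolution_le hρ hρc hG
  have hfc : Continuous (b.normed volume ⋆[lsmul ℝ ℝ] F) :=
    hρc.continuous_convolution_left _ hρ hF.locallyIntegrable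
  have hgc : Continuous (b.normed volume ⋆[lsmul ℝ ℝ] G) :=
    hρc.continuous_convolution_left _ hρ hG.locallyIntegrable
  simp only [Real.norm_eq_abs, sq_abs] at hJF
  set f := b.normed volume ⋆[lsmul ℝ ℝ] F
  set g := b.normed volume ⋆[lsmul ℝ ℝ] G
  have huc : Continuous u := (hfc.pow 2).add continuous_const
  have hu0 : ∀ x, ε ≤ u x := fun x => le_add_of_nonneg_left (sq_nonneg _)
  have hu1 : ∀ x, ‖u x‖ ≤ A ^ 2 + ε := fun x => by
    rw [Real.norm_of_nonneg (hε.le.trans (hu0 x))]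
    have := pow_le_pow_left₀ (norm_nonneg _) (hA x) 2
    rw [Real.norm_eq_abs, sq_abs] at this
    linarith
  have iu : Integrable u (ProbabilityTheory.stdGaussian E) := integrable_stdGaussian_of_bound huc hu1
  have hA0 : 0 ≤ A := (norm_nonneg _).trans (hA 0)
  refine ⟨iu, ?_, ?_, ?_⟩
  · refine integrable_stdGaussian_of_bound (huc.mul (huc.log fun x => (hε.trans_le (hu0 x)).ne'))
      (C := (A ^ 2 + ε) * (|Real.log ε| + |Real.log (A ^ 2 + ε)|)) fun x => ?_
    rw [norm_mul]
    exact mul_le_mul (hu1 x) (abs_log_le hε (hu0 x) ((le_abs_self _).trans (hu1 x)))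
      (norm_nonneg _) (by positivity)
  · have := integral_mono iu (iF.add (integrable_const ε)) fun x => add_le_add_left (hJF x) ε
    rw [integral_add' iF (integrable_const ε)] at this
    simpa using this
  · have hd : ∀ x, HasFDerivAt u (innerSL ℝ ((2 * f x) • g x)) x := fun x => by
      refine (((hderiv x).pow 2).add_const ε).congr_fderiv ?_
      ext z
      simp
    refine (integral_mul_log_le_of_regular hε hu0 hd (by fun_prop) hu1 (L := 2 * A * B)
      fun x => ?_).trans ?_
    · rw [norm_smul, norm_mul, Real.norm_two]
      exact mul_le_mul (by gcongr; exact hA x) (hB x) (norm_nonneg _) (by positivity)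
    · have hle : ∀ x, ‖(2 * f x) • g x‖ ^ 2 / u x ≤
          4 * (b.normed volume ⋆[lsmul ℝ ℝ] fun x => ‖G x‖ ^ 2) x := fun x => by
        refine le_trans ?_ (mul_le_mul_of_nonneg_left (hJG x) (by norm_num))
        rw [div_le_iff₀ (hε.trans_le (hu0 x)), norm_smul, mul_pow, Real.norm_eq_abs, sq_abs]
        have : 0 ≤ ε * ‖g x‖ ^ 2 := by positivity
        simp only [u]
        linarith
      have := integral_mono_of_nonneg (.of_forall fun x =>
        div_nonneg (sq_nonneg _) (hε.le.trans (hu0 x))) (iG.const_mul 4) (.of_forall hle)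
      rw [integral_const_mul] at this
      linarith

/-- The logarithmic Sobolev inequality when the function, its weak gradient and their squares are
Lebesgue integrable. -/
lemma HasWeakGradient.integral_mul_log_le_of_integrable (h : HasWeakGradient F G)
    (hF : Integrable F) (hG : Integrable G) (hF2 : Integrable fun x => F x ^ 2)
    (hG2 : Integrable fun x => ‖G x‖ ^ 2) :
    Integrable (fun x => F x ^ 2 * Real.log (F x ^ 2)) (ProbabilityTheory.stdGaussian E) ∧
    ∫ x, F x ^ 2 * Real.log (F x ^ 2) ∂ProbabilityTheory.stdGaussian E ≤
      2 * (∫ x, ‖G x‖ ^ 2 ∂ProbabilityTheory.stdGaussian E) +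
      (∫ x, F x ^ 2 ∂ProbabilityTheory.stdGaussian E) *
        Real.log (∫ x, F x ^ 2 ∂ProbabilityTheory.stdGaussian E) := by
  let ε : ℕ → ℝ := fun n => 1 / ((n : ℝ) + 1)
  have hε : ∀ n, 0 < ε n := fun n => Nat.one_div_pos_of_nat
  have hε0 : Filter.Tendsto ε Filter.atTop (nhds 0) := tendsto_one_div_add_atTop_nhds_zero_nat
  let b : ℕ → ContDiffBump (0 : E) := fun n => ⟨ε n / 2, ε n, half_pos (hε n), half_lt_self (hε n)⟩
  have hae : ∀ᵐ x ∂ProbabilityTheory.stdGaussian E, Filter.Tendsto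
      (fun n => ((b n).normed volume ⋆[lsmul ℝ ℝ] F) x) Filter.atTop (nhds (F x)) :=
    stdGaussian_absolutelyContinuous.ae_le
    (ContDiffBump.ae_convolution_tendsto_right_of_locallyIntegrable (φ := b) (K := 2) hε0
      (.of_forall fun n => (mul_div_cancel₀ (ε n) two_ne_zero).ge) hF.locallyIntegrable)
  have key := fun n => integral_mul_log_convolution_le h hF hG hF2 hG2 (b n) (hε n)
  refine integrable_mul_log_and_integral_le_of_tendsto
    (u := fun n x => ((b n).normed volume ⋆[lsmul ℝ ℝ] F) x ^ 2 + ε n)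
    (fun n x => add_nonneg (sq_nonneg _) (hε n).le) (fun n => (key n).1) ?_
    (fun n => (key n).2.2.1) ?_ (fun n => (key n).2.1) (fun n => (key n).2.2.2) ?_
  · exact hae.mono fun x hx => by simpa using (hx.pow 2).add hε0
  · simpa using (tendsto_integral_convolution_stdGaussian hF2 (b := b) hε0).add hε0
  · exact (tendsto_integral_convolution_stdGaussian hG2 (b := b) hε0).const_mul 2

end LogSobolevOfIntegrable

section Cutoff

variable {E : Type*} [NormedAddCommGroup E] [InnerProductSpace ℝ E] [FiniteDimensional ℝ E]
  [MeasurableSpace E] [BorelSpace E]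

lemma integrable_smul_of_hasCompactSupport {V : Type*} [NormedAddCommGroup V] [NormedSpace ℝ V]
    {w : E → V} (hw : Integrable w (ProbabilityTheory.stdGaussian E)) {k : E → ℝ}
    (hk : Continuous k) (hkc : HasCompactSupport k) : Integrable fun x => k x • w x := by
  have hp : ∀ x : E, gaussianDensity x ≠ 0 := fun x => (gaussianDensity_pos x).ne'
  have hc : Continuous fun x => k x * (gaussianDensity x)⁻¹ :=
    hk.mul (continuous_gaussianDensity.inv₀ hp)
  obtain ⟨C, hC⟩ := (HasCompactSupport.mul_right (f' := fun x => (gaussianDensity x)⁻¹)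
    hkc).exists_bound_of_continuous hc
  refine ((integrable_stdGaussian_iff.1 hw).bdd_smul C hc.aestronglyMeasurable
    (.of_forall hC)).congr (.of_forall fun x => ?_)
  simp only [Pi.smul_apply', smul_smul, mul_assoc, inv_mul_cancel₀ (hp x), mul_one]

variable {f : E → ℝ} {g : E → E} {χ : E → ℝ} {X : E → E}

lemma HasWeakGradient.mul_cutoff (h : HasWeakGradient f g)
    (hf : Integrable f (ProbabilityTheory.stdGaussian E))
    (hg : Integrable g (ProbabilityTheory.stdGaussian E))
    (hχ : ContDiff ℝ (⊤ : ℕ∞) χ) (hχc : HasCompactSupport χ)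
    (hX : ∀ x, HasFDerivAt χ (innerSL ℝ (X x)) x) (hXc : Continuous X) :
    HasWeakGradient (fun x => χ x * f x) fun x => χ x • g x + f x • X x := by
  intro φ hφ hφc z
  have hφd : Differentiable ℝ φ := hφ.differentiable (by simp)
  have hφ' : Continuous fun x => fderiv ℝ φ x z :=
    (hφ.continuous_fderiv (by simp)).clm_apply continuous_const
  have i1 := integrable_smul_of_hasCompactSupport hf (k := fun x => χ x * fderiv ℝ φ x z)
    (hχ.continuous.mul hφ') hχc.mul_right
  have i2 := integrable_smul_of_hasCompactSupport hf (k := fun x => φ x * inner ℝ (X x) z)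
    (hφ.continuous.mul (by fun_prop)) hφc.mul_right
  have i3 := integrable_smul_of_hasCompactSupport (hg.inner_const (𝕜 := ℝ) z)
    (k := fun x => χ x * φ x) (hχ.continuous.mul hφ.continuous) hχc.mul_right
  simp only [smul_eq_mul] at i1 i2 i3
  have key := h (fun x => χ x * φ x) (hχ.mul hφ) hχc.mul_right z
  have hd : ∀ x, f x * fderiv ℝ (fun x => χ x * φ x) x z
      = χ x * fderiv ℝ φ x z * f x + φ x * inner ℝ (X x) z * f x := fun x => by
    have hm : HasFDerivAt (fun x => χ x * φ x) _ x := (hX x).mul (hφd x).hasFDerivAt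
    rw [hm.fderiv]
    simp
    ring
  simp_rw [hd] at key
  rw [integral_add i1 i2] at key
  have hr : ∀ x, φ x * inner ℝ (χ x • g x + f x • X x) z
      = χ x * φ x * inner ℝ (g x) z + φ x * inner ℝ (X x) z * f x := fun x => by
    rw [inner_add_left, real_inner_smul_left, real_inner_smul_left]
    ring
  simp_rw [hr]
  rw [integral_add i3 i2]
  simp_rw [mul_right_comm _ (fderiv ℝ φ _ z) _] at key
  linarith

lemma norm_add_sq_le_two_mul {V : Type*} [SeminormedAddCommGroup V] (a b : V) :
    ‖a + b‖ ^ 2 ≤ 2 * ‖a‖ ^ 2 + 2 * ‖b‖ ^ 2 := by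
  have := pow_le_pow_left₀ (norm_nonneg _) (norm_add_le a b) 2
  nlinarith [sq_nonneg (‖a‖ - ‖b‖)]

lemma HasWeakGradient.integral_mul_log_cutoff_le (h : HasWeakGradient f g)
    (hf : Integrable f (ProbabilityTheory.stdGaussian E))
    (hg : Integrable g (ProbabilityTheory.stdGaussian E))
    (hf2 : Integrable (fun x => f x ^ 2) (ProbabilityTheory.stdGaussian E))
    (hg2 : Integrable (fun x => ‖g x‖ ^ 2) (ProbabilityTheory.stdGaussian E))
    (hχ : ContDiff ℝ (⊤ : ℕ∞) χ) (hχc : HasCompactSupport χ)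
    (hX : ∀ x, HasFDerivAt χ (innerSL ℝ (X x)) x) (hXc : Continuous X)
    (hXs : HasCompactSupport X) :
    Integrable (fun x => (χ x * f x) ^ 2 * Real.log ((χ x * f x) ^ 2))
      (ProbabilityTheory.stdGaussian E) ∧
    ∫ x, (χ x * f x) ^ 2 * Real.log ((χ x * f x) ^ 2) ∂ProbabilityTheory.stdGaussian E ≤
      2 * (∫ x, ‖χ x • g x + f x • X x‖ ^ 2 ∂ProbabilityTheory.stdGaussian E) +
      (∫ x, (χ x * f x) ^ 2 ∂ProbabilityTheory.stdGaussian E) *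
        Real.log (∫ x, (χ x * f x) ^ 2 ∂ProbabilityTheory.stdGaussian E) := by
  have hac := volume_absolutelyContinuous_stdGaussian (E := E)
  have i1 := integrable_smul_of_hasCompactSupport hf hχ.continuous hχc
  have i2 := integrable_smul_of_hasCompactSupport hg hχ.continuous hχc
  have i3 : Integrable fun x => f x • X x :=
    (integrable_smul_of_hasCompactSupport hf hXc.norm hXs.norm).mono
      ((hf.aestronglyMeasurable.mono_ac hac).smul hXc.aestronglyMeasurable)
      (.of_forall fun x => by simp [norm_smul, mul_comm])
  have hχ2 : HasCompactSupport fun x => χ x ^ 2 :=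
    hχc.comp_left (g := fun t : ℝ => t ^ 2) (zero_pow two_ne_zero)
  have hX2 : HasCompactSupport fun x => ‖X x‖ ^ 2 :=
    hXs.comp_left (g := fun t : E => ‖t‖ ^ 2) (by simp)
  have i4 : Integrable fun x => (χ x * f x) ^ 2 :=
    (integrable_smul_of_hasCompactSupport hf2 (hχ.continuous.pow 2) hχ2).congr
      (.of_forall fun x => (mul_pow (χ x) (f x) 2).symm)
  have i5 : Integrable fun x => χ x ^ 2 * ‖g x‖ ^ 2 :=
    integrable_smul_of_hasCompactSupport hg2 (hχ.continuous.pow 2) hχ2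
  have i6 : Integrable fun x => ‖X x‖ ^ 2 * f x ^ 2 :=
    integrable_smul_of_hasCompactSupport hf2 (hXc.norm.pow 2) hX2
  have i7 : Integrable fun x => χ x • g x + f x • X x := i2.add i3
  have i8 : Integrable fun x => ‖χ x • g x + f x • X x‖ ^ 2 := by
    refine ((i5.const_mul 2).add (i6.const_mul 2)).mono' (i7.aestronglyMeasurable.norm.pow 2)
      (.of_forall fun x => ?_)
    rw [norm_pow, norm_norm]
    refine (norm_add_sq_le_two_mul _ _).trans (le_of_eq ?_)
    simp [norm_smul, mul_pow, mul_comm]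
  exact (h.mul_cutoff hf hg hχ hχc hX hXc).integral_mul_log_le_of_integrable i1 i7 i4 i8

/-- The Gaussian logarithmic Sobolev inequality for the square of a weakly differentiable
function. -/
lemma HasWeakGradient.integral_sq_mul_log_sq_le (h : HasWeakGradient f g)
    (hfm : AEStronglyMeasurable f (ProbabilityTheory.stdGaussian E))
    (hgm : AEStronglyMeasurable g (ProbabilityTheory.stdGaussian E))
    (hf2 : Integrable (fun x => f x ^ 2) (ProbabilityTheory.stdGaussian E))
    (hg2 : Integrable (fun x => ‖g x‖ ^ 2) (ProbabilityTheory.stdGaussian E)) :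
    Integrable (fun x => f x ^ 2 * Real.log (f x ^ 2)) (ProbabilityTheory.stdGaussian E) ∧
    ∫ x, f x ^ 2 * Real.log (f x ^ 2) ∂ProbabilityTheory.stdGaussian E ≤
      2 * (∫ x, ‖g x‖ ^ 2 ∂ProbabilityTheory.stdGaussian E) +
      (∫ x, f x ^ 2 ∂ProbabilityTheory.stdGaussian E) *
        Real.log (∫ x, f x ^ 2 ∂ProbabilityTheory.stdGaussian E) := by
  have := FiniteDimensional.complete ℝ E
  have hf : Integrable f (ProbabilityTheory.stdGaussian E) :=
    ((memLp_two_iff_integrable_sq hfm).2 hf2).integrable one_le_two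
  have hg : Integrable g (ProbabilityTheory.stdGaussian E) :=
    ((memLp_two_iff_integrable_sq_norm hgm).2 hg2).integrable one_le_two
  let χ : ContDiffBump (0 : E) := ⟨1, 2, one_pos, one_lt_two⟩
  have hχ : ContDiff ℝ (⊤ : ℕ∞) χ := χ.contDiff
  let X : E → E := fun x => (InnerProductSpace.toDual ℝ E).symm (fderiv ℝ χ x)
  have hX : ∀ x, HasFDerivAt χ (innerSL ℝ (X x)) x := fun x => by
    refine ((hχ.differentiable (by simp)) x).hasFDerivAt.congr_fderiv ?_
    ext z
    simp [X]
  have hXc : Continuous X :=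
    (InnerProductSpace.toDual ℝ E).symm.continuous.comp (hχ.continuous_fderiv (by simp))
  have hXs : HasCompactSupport X := (χ.hasCompactSupport.fderiv (𝕜 := ℝ)).comp_left (map_zero _)
  obtain ⟨C, hC⟩ := hXs.exists_bound_of_continuous hXc
  let ε : ℕ → ℝ := fun n => 1 / ((n : ℝ) + 1)
  have hε : ∀ n, 0 < ε n := fun n => Nat.one_div_pos_of_nat
  have hε1 : ∀ n, ε n ≤ 1 := fun n => by
    rw [div_le_one (by positivity)]
    linarith [n.cast_nonneg (α := ℝ)]
  have hε0 : Filter.Tendsto ε Filter.atTop (nhds 0) := tendsto_one_div_add_atTop_nhds_zero_nat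
  have hχ1 : ∀ x : E, Filter.Tendsto (fun n => χ (ε n • x)) Filter.atTop (nhds 1) := fun x => by
    have h1 := (hχ.continuous.tendsto ((0 : ℝ) • x)).comp (hε0.smul_const x)
    rwa [zero_smul, χ.one_of_mem_closedBall (Metric.mem_closedBall_self χ.rIn_pos.le)] at h1
  have hXd : ∀ n x, HasFDerivAt (fun x => χ (ε n • x)) (innerSL ℝ (ε n • X (ε n • x))) x :=
    fun n x => by
      have h1 : HasFDerivAt (fun x : E => ε n • x) (ε n • ContinuousLinearMap.id ℝ E) x :=
        (hasFDerivAt_id x).const_smul _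
      refine ((hX _).comp x h1).congr_fderiv ?_
      ext z
      simp
  have hXb : ∀ n x, ‖ε n • X (ε n • x)‖ ≤ ε n * C := fun n x => by
    rw [norm_smul, Real.norm_of_nonneg (hε n).le]
    exact mul_le_mul_of_nonneg_left (hC _) (hε n).le
  have hX0 : ∀ x : E, Filter.Tendsto (fun n => ε n • X (ε n • x)) Filter.atTop (nhds 0) :=
    fun x => squeeze_zero_norm (fun n => hXb n x) (by simpa using hε0.mul_const C)
  have hXs' : ∀ n, HasCompactSupport fun x => ε n • X (ε n • x) := fun n =>
    (hXs.comp_smul (hε n).ne').comp_left (g := fun y => ε n • y) (smul_zero _)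
  have hχc : ∀ n, ContDiff ℝ (⊤ : ℕ∞) fun x => χ (ε n • x) := fun n =>
    hχ.comp (contDiff_const.smul contDiff_id)
  have key := fun n => h.integral_mul_log_cutoff_le hf hg hf2 hg2 (hχc n)
    (χ.hasCompactSupport.comp_smul (hε n).ne') (hXd n) (by fun_prop) (hXs' n)
  have hle : ∀ n x, (χ (ε n • x) * f x) ^ 2 ≤ f x ^ 2 := fun n x => by
    rw [mul_pow]
    exact mul_le_of_le_one_left (sq_nonneg _) (pow_le_one₀ χ.nonneg χ.le_one)
  have iu : ∀ n, Integrable (fun x => (χ (ε n • x) * f x) ^ 2)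
      (ProbabilityTheory.stdGaussian E) := fun n =>
    hf2.mono' (((hχc n).continuous.aestronglyMeasurable.mul hfm).pow 2) (.of_forall fun x => by
      rw [norm_pow, Real.norm_eq_abs, sq_abs]
      exact hle n x)
  refine integrable_mul_log_and_integral_le_of_tendsto
    (u := fun n x => (χ (ε n • x) * f x) ^ 2) (fun n x => sq_nonneg _) iu
    (.of_forall fun x => by simpa using (((hχ1 x).mul_const (f x)).pow 2))
    (fun n => integral_mono (iu n) hf2 (hle n)) tendsto_const_nhds
    (fun n => (key n).1) (fun n => (key n).2) (Filter.Tendsto.const_mul 2 ?_)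
  refine tendsto_integral_of_dominated_convergence (fun x => 2 * ‖g x‖ ^ 2 + 2 * (C ^ 2 * f x ^ 2))
    (fun n => (((hχc n).continuous.aestronglyMeasurable.smul hgm).add
      (hfm.smul (Continuous.aestronglyMeasurable (by fun_prop)))).norm.pow 2)
    ((hg2.const_mul 2).add ((hf2.const_mul _).const_mul 2))
    (fun n => .of_forall fun x => ?_) (.of_forall fun x => ?_)
  · rw [norm_pow, norm_norm]
    refine (norm_add_sq_le_two_mul _ _).trans ?_
    gcongr
    · rw [norm_smul, Real.norm_of_nonneg χ.nonneg]
      exact mul_le_of_le_one_left (norm_nonneg _) χ.le_one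
    · rw [norm_smul, mul_pow, mul_comm, Real.norm_eq_abs, sq_abs]
      refine mul_le_mul_of_nonneg_right (pow_le_pow_left₀ (norm_nonneg _) ?_ 2) (sq_nonneg _)
      exact (hXb n x).trans (mul_le_of_le_one_left ((norm_nonneg _).trans (hC 0)) (hε1 n))
  · have := (((hχ1 x).smul_const (g x)).add ((hX0 x).const_smul (f x))).norm.pow 2
    simpa using this

end Cutoff

lemma stdGaussian_eq {d : ℕ} : _root_.stdGaussian d = ProbabilityTheory.stdGaussian (Ed d) :=
  map_pi_eq_stdGaussian

lemma IsWeakGradient.hasWeakGradient {d : ℕ} {f : Ed d → ℝ} {g : Ed d → Ed d}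
    (h : IsWeakGradient f g) (hf : Integrable f (ProbabilityTheory.stdGaussian (Ed d)))
    (hg : Integrable g (ProbabilityTheory.stdGaussian (Ed d))) : HasWeakGradient f g := by
  intro φ hφ hφc z
  have hac := volume_absolutelyContinuous_stdGaussian (E := Ed d)
  have hc : Continuous (gradient φ) :=
    (InnerProductSpace.toDual ℝ (Ed d)).symm.continuous.comp (hφ.continuous_fderiv (by simp))
  have hs : HasCompactSupport (gradient φ) := (hφc.fderiv (𝕜 := ℝ)).comp_left (map_zero _)
  have i1 : Integrable fun x => f x • gradient φ x :=
    (integrable_smul_of_hasCompactSupport hf hc.norm hs.norm).mono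
      ((hf.aestronglyMeasurable.mono_ac hac).smul hc.aestronglyMeasurable)
      (.of_forall fun x => by simp [norm_smul, mul_comm])
  have i2 := integrable_smul_of_hasCompactSupport hg hφ.continuous hφc
  have key := congrArg (inner ℝ z) (h φ hφ hφc)
  rw [inner_neg_right, ← integral_inner i1, ← integral_inner i2] at key
  have hgr : ∀ x, inner ℝ z (gradient φ x) = fderiv ℝ φ x z := fun x => by
    rw [real_inner_comm]
    exact InnerProductSpace.toDual_symm_apply
  simp_rw [inner_smul_right, hgr] at key
  simpa only [real_inner_comm] using key

/-- **The Gaussian logarithmic Sobolev inequality** (inequality (3.4)): for any weakly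
differentiable `f ∈ L²(γ)` with `|∇f| ∈ L²(γ)`,
`∫ |f|² log|f| dγ ≤ ‖|∇f|‖²_{L²(γ)} + ‖f‖²_{L²(γ)} log ‖f‖_{L²(γ)}`. -/
theorem gaussian_logSobolev {d : ℕ} (f : Ed d → ℝ) (g : Ed d → Ed d)
    (hfm : AEStronglyMeasurable f (stdGaussian d))
    (hgm : AEStronglyMeasurable g (stdGaussian d))
    (hweak : IsWeakGradient f g)
    (hf2 : Integrable (fun x => (f x) ^ 2) (stdGaussian d))
    (hg2 : Integrable (fun x => ‖g x‖ ^ 2) (stdGaussian d)) :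
    ∫ x, (f x) ^ 2 * Real.log |f x| ∂(stdGaussian d)
      ≤ (∫ x, ‖g x‖ ^ 2 ∂(stdGaussian d))
        + (∫ x, (f x) ^ 2 ∂(stdGaussian d))
          * Real.log (Real.sqrt (∫ x, (f x) ^ 2 ∂(stdGaussian d))) := by
  rw [stdGaussian_eq] at *
  have hf := ((memLp_two_iff_integrable_sq hfm).2 hf2).integrable one_le_two
  have hg := ((memLp_two_iff_integrable_sq_norm hgm).2 hg2).integrable one_le_two
  obtain ⟨-, h⟩ := (hweak.hasWeakGradient hf hg).integral_sq_mul_log_sq_le hfm hgm hf2 hg2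
  have hlog : ∀ x, f x ^ 2 * Real.log (f x ^ 2) = 2 * (f x ^ 2 * Real.log |f x|) := fun x => by
    rw [Real.log_pow, Real.log_abs]
    push_cast
    ring
  simp_rw [hlog] at h
  rw [integral_const_mul] at h
  rw [Real.log_sqrt (integral_nonneg fun x => sq_nonneg _)]
  linarith
end
end
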